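/- arXiv:2010.02721 — 5 statements merged into one kernel-verified Lean document; each statement's English description precedes it below -/
import Mathlib

section
/- Let n ≥ 1, let q ≥ 2 be an integer, and let 0 ≤ ε ≤ 1/2. Set λ = 1 + (1/(q-1))·log₂(ε^q + (1-ε)^q). Then for every nonnegative function f on {0,1}^n that is not identically zero, log ‖T_ε f‖_q ≤ E_{T∼λ} log ‖E(f|T)‖_q, i.e. log of the ℓ_q norm of T_ε f is at most Σ_{T⊆[n]} λ^{|T|}(1-λ)^{n-|T|} · log ‖E(f|T)‖_q. -/
/-- Hamming distance between two points of the boolean cube `{0,1}^n`. -/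
def hamDist {n : ℕ} (x y : Fin n → Bool) : ℕ :=
  (Finset.univ.filter fun i => x i ≠ y i).card

/-- The noise operator `T_ε` on functions on the boolean cube:
`(T_ε f)(x) = Σ_y ε^{|y-x|} (1-ε)^{n-|y-x|} f(y)`. -/
noncomputable def noiseOp {n : ℕ} (ε : ℝ) (f : (Fin n → Bool) → ℝ) : (Fin n → Bool) → ℝ :=
  fun x => ∑ y : Fin n → Bool, ε ^ hamDist x y * (1 - ε) ^ (n - hamDist x y) * f y

/-- The `ℓ_q` norm with respect to the uniform measure on the boolean cube. -/
noncomputable def lqNorm {n : ℕ} (q : ℕ) (f : (Fin n → Bool) → ℝ) : ℝ :=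
  (((2 : ℝ) ^ n)⁻¹ * ∑ x : Fin n → Bool, |f x| ^ q) ^ ((1 : ℝ) / q)

/-- Conditional expectation of `f` given the coordinates in `T`:
`E(f|T)(x)` is the average of `f(y)` over all `y` agreeing with `x` on `T`. -/
noncomputable def condExp {n : ℕ} (f : (Fin n → Bool) → ℝ) (T : Finset (Fin n)) :
    (Fin n → Bool) → ℝ :=
  fun x =>
    (∑ y ∈ Finset.univ.filter (fun y : Fin n → Bool => ∀ i ∈ T, y i = x i), f y) /
      ((Finset.univ.filter (fun y : Fin n → Bool => ∀ i ∈ T, y i = x i)).card : ℝ)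

/-- `x ^ m` times the sum `x ^ j + x ^ (-j)`, written without negative exponents. -/
def symmPow (m j : ℕ) (x : ℝ) : ℝ := x ^ (m + j) + x ^ (m - j)

lemma symmPow_mul_le {m j k : ℕ} (hjk : j ≤ k) (hkm : k ≤ m) {x y : ℝ} (hx : 0 ≤ x)
    (hxy : x ≤ y) (hy : y ≤ 1) :
    symmPow m j x * symmPow m k y ≤ symmPow m j y * symmPow m k x := by
  obtain ⟨d, rfl⟩ := Nat.exists_eq_add_of_le hjk
  obtain ⟨e, rfl⟩ := Nat.exists_eq_add_of_le hkm
  have hy0 : 0 ≤ y := hx.trans hxy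
  have hxy1 : x * y ≤ 1 := mul_le_one₀ (hxy.trans hy) hy0 hy
  have hxy0 : 0 ≤ x * y := mul_nonneg hx hy0
  have key : 0 ≤ (y ^ d - x ^ d) * (1 - (x * y) ^ (2 * j + d)) +
      (y ^ (2 * j + d) - x ^ (2 * j + d)) * (1 - (x * y) ^ d) := by
    have h1 := pow_le_pow_left₀ hx hxy d
    have h2 := pow_le_pow_left₀ hx hxy (2 * j + d)
    have h3 := pow_le_one₀ (n := d) hxy0 hxy1
    have h4 := pow_le_one₀ (n := 2 * j + d) hxy0 hxy1
    exact add_nonneg (mul_nonneg (by linarith) (by linarith))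
      (mul_nonneg (by linarith) (by linarith))
  have key2 := mul_nonneg (pow_nonneg hxy0 e) key
  unfold symmPow
  rw [show j + d + e - j = d + e by lia, show j + d + e - (j + d) = e by lia]
  refine le_of_sub_nonneg (key2.trans_eq ?_)
  ring

lemma sum_symmPow (m : ℕ) (x : ℝ) :
    ∑ j ∈ Finset.range m, symmPow m (j + 1) x =
      (1 + x ^ (m + 1)) * ∑ j ∈ Finset.range m, x ^ j := by
  have h := Finset.sum_range_reflect (fun j => x ^ j) m
  simp only [symmPow, Finset.sum_add_distrib]
  rw [add_mul, one_mul, ← h, add_comm, h]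
  congr 1
  · rw [← h]
    exact Finset.sum_congr rfl fun j _ => by congr 1; lia
  · rw [Finset.mul_sum]
    exact Finset.sum_congr rfl fun j _ => by ring

/-- The numerator of the elasticity ratio in the coordinate `x = (1 - s) / (1 + s)`. -/
def elastNum (m : ℕ) (x : ℝ) : ℝ :=
  m * (1 + x ^ (m - 1)) * (1 + x ^ (m + 1)) - (m + 1) * (1 - x ^ m) ^ 2

lemma elastNum_eq {m : ℕ} (hm : 1 ≤ m) (x : ℝ) :
    elastNum m x = (m + 1) * symmPow m 0 x + m * symmPow m 1 x - symmPow m m x := by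
  obtain ⟨k, rfl⟩ := Nat.exists_eq_add_of_le' hm
  simp only [elastNum, symmPow, Nat.add_sub_cancel, Nat.sub_self, Nat.sub_zero]
  ring

lemma elastNum_mul_le {m : ℕ} (hm : 1 ≤ m) {x y : ℝ} (hx : 0 ≤ x) (hxy : x ≤ y) (hy : y ≤ 1) :
    elastNum m x * ∑ j ∈ Finset.range m, symmPow m (j + 1) y ≤
      elastNum m y * ∑ j ∈ Finset.range m, symmPow m (j + 1) x := by
  rw [elastNum_eq hm, elastNum_eq hm, Finset.mul_sum, Finset.mul_sum]
  refine Finset.sum_le_sum fun j hj => ?_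
  have hj' : j + 1 ≤ m := Finset.mem_range.1 hj
  have h0 := symmPow_mul_le (Nat.zero_le (j + 1)) hj' hx hxy hy
  have h1 := symmPow_mul_le (Nat.le_add_left 1 j) hj' hx hxy hy
  have h2 := symmPow_mul_le hj' le_rfl hx hxy hy
  have hm0 : (0 : ℝ) ≤ m := m.cast_nonneg
  have := mul_le_mul_of_nonneg_left h0 (by linarith : (0 : ℝ) ≤ m + 1)
  have := mul_le_mul_of_nonneg_left h1 hm0
  linarith

/-- The even part `((1 + s) ^ q + (1 - s) ^ q) / 2` of `(1 + s) ^ q`. -/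
noncomputable def evenPow (q : ℕ) (s : ℝ) : ℝ := ((1 + s) ^ q + (1 - s) ^ q) / 2

/-- The odd part `((1 + s) ^ q - (1 - s) ^ q) / 2` of `(1 + s) ^ q`. -/
noncomputable def oddPow (q : ℕ) (s : ℝ) : ℝ := ((1 + s) ^ q - (1 - s) ^ q) / 2

lemma hasDerivAt_evenPow (m : ℕ) (s : ℝ) :
    HasDerivAt (evenPow (m + 1)) ((m + 1) * oddPow m s) s := by
  have h1 := ((hasDerivAt_id s).const_add 1).fun_pow (m + 1)
  have h2 := ((hasDerivAt_id s).const_sub 1).fun_pow (m + 1)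
  refine ((h1.fun_add h2).div_const 2).congr_deriv ?_
  simp [oddPow]
  ring

lemma hasDerivAt_oddPow (m : ℕ) (s : ℝ) :
    HasDerivAt (oddPow m) (m * evenPow (m - 1) s) s := by
  have h1 := ((hasDerivAt_id s).const_add 1).fun_pow m
  have h2 := ((hasDerivAt_id s).const_sub 1).fun_pow m
  refine ((h1.fun_sub h2).div_const 2).congr_deriv ?_
  simp [evenPow]
  ring

lemma one_le_evenPow (q : ℕ) {s : ℝ} (h0 : 0 ≤ s) (h1 : s ≤ 1) : 1 ≤ evenPow q s := by
  have := one_add_mul_le_pow (by linarith : -2 ≤ s) q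
  have h := one_add_mul_le_pow (by linarith : -2 ≤ -s) q
  rw [← sub_eq_add_neg 1 s] at h
  unfold evenPow
  linarith

lemma one_lt_evenPow {q : ℕ} (hq : 2 ≤ q) {s : ℝ} (h0 : 0 < s) (h1 : s ≤ 1) :
    1 < evenPow q s := by
  have := one_add_mul_self_lt_rpow_one_add (by linarith : -1 ≤ s) h0.ne'
    (by exact_mod_cast hq : (1 : ℝ) < q)
  have h := one_add_mul_self_lt_rpow_one_add (by linarith : -1 ≤ -s) (neg_ne_zero.2 h0.ne')
    (by exact_mod_cast hq : (1 : ℝ) < q)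
  rw [Real.rpow_natCast] at this h
  rw [← sub_eq_add_neg 1 s] at h
  unfold evenPow
  linarith

lemma oddPow_pos {m : ℕ} (hm : 1 ≤ m) {s : ℝ} (h0 : 0 < s) (h1 : s ≤ 1) : 0 < oddPow m s := by
  have := pow_lt_pow_left₀ (by linarith : 1 - s < 1 + s) (by linarith) (by lia : m ≠ 0)
  unfold oddPow
  linarith

/-- The ratio of the derivatives of `s F'(s)` and `F(s)`, for `F = log (evenPow (m + 1))`. -/
noncomputable def elastRatio (m : ℕ) (s : ℝ) : ℝ :=
  1 + s * m * evenPow (m - 1) s / oddPow m s - s * (m + 1) * oddPow m s / evenPow (m + 1) s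

lemma elastRatio_eq {m : ℕ} (hm : 1 ≤ m) {x : ℝ} (hx0 : 0 < x) (hx1 : x < 1) :
    elastRatio m ((1 - x) / (1 + x)) =
      1 + elastNum m x / (2 * ∑ j ∈ Finset.range m, symmPow m (j + 1) x) := by
  have hG : 0 < ∑ j ∈ Finset.range m, x ^ j :=
    Finset.sum_pos (fun j _ => by positivity) (Finset.nonempty_range_iff.2 (by lia))
  have hG1 : 1 - x ^ m = (1 - x) * ∑ j ∈ Finset.range m, x ^ j := (mul_neg_geom_sum x m).symm
  rw [sum_symmPow, elastRatio, evenPow, evenPow, oddPow, elastNum, hG1]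
  have e1 : 1 + (1 - x) / (1 + x) = 2 / (1 + x) := by field_simp; ring
  have e2 : 1 - (1 - x) / (1 + x) = 2 / (1 + x) * x := by field_simp; ring
  rw [e1, e2]
  obtain ⟨k, rfl⟩ := Nat.exists_eq_add_of_le' hm
  set u := 2 / (1 + x) with hu
  have hu0 : 0 < u := by positivity
  have e3 : (1 - x) / (1 + x) = (1 - x) * u / 2 := by rw [hu]; ring
  rw [e3]
  set G := ∑ j ∈ Finset.range (k + 1), x ^ j
  have e4 : (u ^ (k + 1) - (u * x) ^ (k + 1)) = u ^ (k + 1) * ((1 - x) * G) := by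
    rw [← hG1]; ring
  rw [e4, Nat.add_sub_cancel]
  have h1x : 0 < 1 - x := by linarith
  have e5 : ∀ r, u ^ r + (u * x) ^ r = u ^ r * (1 + x ^ r) := fun r => by ring
  rw [e5, e5]
  have h2 : 0 < 1 + x ^ (k + 1 + 1) := by positivity
  generalize x ^ k = a at *
  generalize x ^ (k + 1 + 1) = b at *
  field_simp
  ring

lemma elastRatio_anti {m : ℕ} (hm : 1 ≤ m) {s t : ℝ} (hs : 0 < s) (hst : s ≤ t) (ht : t < 1) :
    elastRatio m t ≤ elastRatio m s := by
  have param : ∀ r : ℝ, 0 < r → r < 1 → ∃ x, 0 < x ∧ x < 1 ∧ x = (1 - r) / (1 + r) ∧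
      (1 - x) / (1 + x) = r := fun r h0 h1 => by
    refine ⟨(1 - r) / (1 + r), div_pos (by linarith) (by linarith), ?_, rfl, ?_⟩
    · rw [div_lt_one (by linarith)]; linarith
    · have : 0 < 1 + r := by linarith
      field_simp
      ring
  obtain ⟨x, hx0, hx1, hx, rfl⟩ := param t (hs.trans_le hst) ht
  obtain ⟨y, hy0, hy1, hy, rfl⟩ := param s hs (hst.trans_lt ht)
  have hxy : x ≤ y := by
    rw [div_le_div_iff₀ (by linarith) (by linarith)] at hst
    linarith
  have pos : ∀ z : ℝ, 0 < z → 0 < ∑ j ∈ Finset.range m, symmPow m (j + 1) z := fun z hz =>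
    Finset.sum_pos (fun j _ => by unfold symmPow; positivity)
      (Finset.nonempty_range_iff.2 (by lia))
  rw [elastRatio_eq hm hx0 hx1, elastRatio_eq hm hy0 hy1]
  have := elastNum_mul_le hm hx0.le hxy hy1.le
  have := pos x hx0
  have := pos y hy0
  gcongr 1 + ?_
  rw [div_le_div_iff₀ (by linarith) (by linarith)]
  linarith

/-- `s F'(s)` for `F = log (evenPow (m + 1))`. -/
noncomputable def scaledDeriv (m : ℕ) (s : ℝ) : ℝ :=
  s * ((m + 1) * oddPow m s / evenPow (m + 1) s)

lemma hasDerivAt_log_evenPow (m : ℕ) {s : ℝ} (h0 : 0 ≤ s) (h1 : s ≤ 1) :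
    HasDerivAt (fun s => Real.log (evenPow (m + 1) s))
      ((m + 1) * oddPow m s / evenPow (m + 1) s) s :=
  (hasDerivAt_evenPow m s).log (by linarith [one_le_evenPow (m + 1) h0 h1])

lemma differentiableAt_scaledDeriv (m : ℕ) {s : ℝ} (h0 : 0 ≤ s) (h1 : s ≤ 1) :
    DifferentiableAt ℝ (scaledDeriv m) s := by
  have hP := one_le_evenPow (m + 1) h0 h1
  exact differentiableAt_id.mul ((((hasDerivAt_oddPow m s).differentiableAt).const_mul _).div
    (hasDerivAt_evenPow m s).differentiableAt (by linarith))

lemma hasDerivAt_scaledDeriv {m : ℕ} (hm : 1 ≤ m) {s : ℝ} (h0 : 0 < s) (h1 : s ≤ 1) :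
    HasDerivAt (scaledDeriv m)
      (elastRatio m s * ((m + 1) * oddPow m s / evenPow (m + 1) s)) s := by
  have hP := one_le_evenPow (m + 1) h0.le h1
  have hQ := oddPow_pos hm h0 h1
  refine ((hasDerivAt_id s).mul (((hasDerivAt_oddPow m s).const_mul ((m : ℝ) + 1)).div
    (hasDerivAt_evenPow m s) (by linarith))).congr_deriv ?_
  have hP' : evenPow (m + 1) s ≠ 0 := by linarith
  simp only [id, elastRatio, Pi.div_apply]
  field_simp
  ring

lemma elastRatio_mul_log_le {m : ℕ} (hm : 1 ≤ m) {s : ℝ} (h0 : 0 < s) (h1 : s < 1) :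
    elastRatio m s * Real.log (evenPow (m + 1) s) ≤ scaledDeriv m s := by
  obtain ⟨c, ⟨hc0, hcs⟩, hc⟩ := exists_ratio_hasDerivAt_eq_ratio_slope
    (fun s => Real.log (evenPow (m + 1) s)) _ h0
    (fun x hx => (hasDerivAt_log_evenPow m hx.1 (hx.2.trans h1.le)).continuousAt.continuousWithinAt)
    (fun x hx => hasDerivAt_log_evenPow m hx.1.le (hx.2.le.trans h1.le))
    (scaledDeriv m) _
    (fun x hx => (differentiableAt_scaledDeriv m hx.1
      (hx.2.trans h1.le)).continuousAt.continuousWithinAt)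
    (fun x hx => hasDerivAt_scaledDeriv hm hx.1 (hx.2.le.trans h1.le))
  have hF0 : Real.log (evenPow (m + 1) 0) = 0 := by simp [evenPow]
  have hE0 : scaledDeriv m 0 = 0 := by simp [scaledDeriv]
  rw [hF0, hE0, sub_zero, sub_zero] at hc
  have hP := one_le_evenPow (m + 1) hc0.le (hcs.le.trans h1.le)
  have hQ := oddPow_pos hm hc0 (hcs.le.trans h1.le)
  have hd : 0 < (m + 1) * oddPow m c / evenPow (m + 1) c := by positivity
  have hE : scaledDeriv m s = Real.log (evenPow (m + 1) s) * elastRatio m c :=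
    mul_right_cancel₀ hd.ne' (by linarith)
  rw [hE, mul_comm]
  exact mul_le_mul_of_nonneg_left (elastRatio_anti hm hc0 hcs.le h1)
    (Real.log_nonneg (one_le_evenPow _ h0.le h1.le))

lemma antitoneOn_elasticity {m : ℕ} (hm : 1 ≤ m) :
    AntitoneOn (fun s => scaledDeriv m s / Real.log (evenPow (m + 1) s)) (Set.Ioo 0 1) := by
  have hF : ∀ s ∈ Set.Ioo (0 : ℝ) 1, 0 < Real.log (evenPow (m + 1) s) := fun s hs =>
    Real.log_pos (one_lt_evenPow (by lia) hs.1 hs.2.le)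
  have hd : ∀ s ∈ Set.Ioo (0 : ℝ) 1, HasDerivAt
      (fun s => scaledDeriv m s / Real.log (evenPow (m + 1) s)) _ s := fun s hs =>
    (hasDerivAt_scaledDeriv hm hs.1 hs.2.le).fun_div
      (hasDerivAt_log_evenPow m hs.1.le hs.2.le) (hF s hs).ne'
  refine antitoneOn_of_deriv_nonpos (convex_Ioo 0 1)
    (fun s hs => (hd s hs).continuousAt.continuousWithinAt)
    (fun s hs => (hd s (interior_subset hs)).differentiableAt.differentiableWithinAt) ?_
  intro s hs
  rw [interior_Ioo] at hs
  rw [(hd s hs).deriv]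
  refine div_nonpos_of_nonpos_of_nonneg ?_ (sq_nonneg _)
  have h1 := elastRatio_mul_log_le hm hs.1 hs.2
  have hP := one_le_evenPow (m + 1) hs.1.le hs.2.le
  have hQ := oddPow_pos hm hs.1 hs.2.le
  have hpos : 0 < (m + 1) * oddPow m s / evenPow (m + 1) s := by positivity
  nlinarith [mul_le_mul_of_nonneg_right h1 hpos.le]

lemma log_evenPow_mul_le {q : ℕ} (hq : 2 ≤ q) {r s : ℝ} (hr0 : 0 ≤ r) (hr1 : r ≤ 1)
    (hs0 : 0 ≤ s) (hs1 : s ≤ 1) :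
    Real.log (evenPow q (r * s)) * Real.log (evenPow q 1) ≤
      Real.log (evenPow q r) * Real.log (evenPow q s) := by
  obtain ⟨m, rfl⟩ := Nat.exists_eq_add_of_le' (by lia : 1 ≤ q)
  have hm : 1 ≤ m := by lia
  have hF0 : Real.log (evenPow (m + 1) 0) = 0 := by simp [evenPow]
  rcases hr0.eq_or_lt with rfl | hr0
  · simp [hF0]
  rcases hs0.eq_or_lt with rfl | hs0
  · simp [hF0]
  rcases hr1.eq_or_lt with rfl | hr1
  · rw [one_mul, mul_comm]
  have hF : ∀ s : ℝ, 0 < s → s ≤ 1 → 0 < Real.log (evenPow (m + 1) s) := fun s h0 h1 =>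
    Real.log_pos (one_lt_evenPow hq h0 h1)
  have hrs : ∀ s ∈ Set.Ioc (0 : ℝ) 1, 0 < r * s ∧ r * s < 1 := fun s hs =>
    ⟨mul_pos hr0 hs.1, by nlinarith [hs.1, hs.2]⟩
  have hd : ∀ s ∈ Set.Ioc (0 : ℝ) 1, HasDerivAt
      (fun s => Real.log (evenPow (m + 1) (r * s)) / Real.log (evenPow (m + 1) s)) _ s :=
    fun s hs => (HasDerivAt.comp s
      (hasDerivAt_log_evenPow m (hrs s hs).1.le (hrs s hs).2.le)
      ((hasDerivAt_id s).const_mul r)).fun_div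
      (hasDerivAt_log_evenPow m hs.1.le hs.2) (hF s hs.1 hs.2).ne'
  have hmono : MonotoneOn
      (fun s => Real.log (evenPow (m + 1) (r * s)) / Real.log (evenPow (m + 1) s))
      (Set.Ioc 0 1) := by
    refine monotoneOn_of_deriv_nonneg (convex_Ioc 0 1)
      (fun s hs => (hd s hs).continuousAt.continuousWithinAt)
      (fun s hs => (hd s (interior_subset hs)).differentiableAt.differentiableWithinAt) ?_
    intro s hs
    rw [interior_Ioc] at hs
    have hs' : s ∈ Set.Ioc (0 : ℝ) 1 := ⟨hs.1, hs.2.le⟩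
    obtain ⟨h0, h1⟩ := hrs s hs'
    rw [(hd s hs').deriv]
    refine div_nonneg ?_ (sq_nonneg _)
    have hle : r * s ≤ s := by nlinarith [hs.1]
    have key := antitoneOn_elasticity hm ⟨h0, h1⟩ hs hle
    simp only at key
    rw [div_le_div_iff₀ (hF s hs.1 hs.2.le) (hF _ h0 h1.le)] at key
    unfold scaledDeriv at key
    refine nonneg_of_mul_nonneg_right ?_ hs.1
    simp only [Function.comp]
    linarith
  have h := hmono ⟨hs0, hs1⟩ ⟨one_pos, le_rfl⟩ hs1
  simp only [mul_one] at h
  rwa [div_le_div_iff₀ (hF s hs0 hs1) (hF 1 one_pos le_rfl)] at h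

/-- The sampling probability `λ` attached to the noise `ε` and the exponent `q`. -/
noncomputable def sampleProb (q : ℕ) (ε : ℝ) : ℝ :=
  1 + 1 / ((q : ℝ) - 1) * Real.logb 2 (ε ^ q + (1 - ε) ^ q)

lemma log_evenPow_one {q : ℕ} (hq : 1 ≤ q) :
    Real.log (evenPow q 1) = ((q : ℝ) - 1) * Real.log 2 := by
  have h : (evenPow q 1) = 2 ^ q / 2 := by
    rw [evenPow, sub_self, zero_pow (by lia), add_zero]
    norm_num
  rw [h, Real.log_div (by positivity) two_ne_zero, Real.log_pow]
  ring

lemma log_evenPow_noise {q : ℕ} (hq : 2 ≤ q) {ε : ℝ} (h0 : 0 ≤ ε) (h1 : ε ≤ 1 / 2) :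
    Real.log (evenPow q (1 - 2 * ε)) = sampleProb q ε * Real.log (evenPow q 1) := by
  have hpos : 0 < ε ^ q + (1 - ε) ^ q := by
    have : 0 < 1 - ε := by linarith
    positivity
  have h : evenPow q (1 - 2 * ε) = 2 ^ q / 2 * (ε ^ q + (1 - ε) ^ q) := by
    rw [evenPow, show 1 + (1 - 2 * ε) = 2 * (1 - ε) by ring,
      show 1 - (1 - 2 * ε) = 2 * ε by ring, mul_pow, mul_pow]
    ring
  have hq' : (q : ℝ) - 1 ≠ 0 := by
    have : (2 : ℝ) ≤ q := by exact_mod_cast hq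
    linarith
  have hl : Real.log 2 ≠ 0 := (Real.log_pos one_lt_two).ne'
  rw [log_evenPow_one (by lia), h, Real.log_mul (by positivity) hpos.ne',
    Real.log_div (by positivity) two_ne_zero, Real.log_pow, sampleProb, Real.logb]
  field_simp

lemma log_evenPow_one_pos {q : ℕ} (hq : 2 ≤ q) : 0 < Real.log (evenPow q 1) :=
  Real.log_pos (one_lt_evenPow hq one_pos le_rfl)

lemma sampleProb_nonneg {q : ℕ} (hq : 2 ≤ q) {ε : ℝ} (h0 : 0 ≤ ε) (h1 : ε ≤ 1 / 2) :
    0 ≤ sampleProb q ε := by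
  refine nonneg_of_mul_nonneg_left ?_ (log_evenPow_one_pos hq)
  rw [← log_evenPow_noise hq h0 h1]
  exact Real.log_nonneg (one_le_evenPow q (by linarith) (by linarith))

lemma sampleProb_le_one {q : ℕ} (hq : 2 ≤ q) {ε : ℝ} (h0 : 0 ≤ ε) (h1 : ε ≤ 1 / 2) :
    sampleProb q ε ≤ 1 := by
  have hle : ε ^ q + (1 - ε) ^ q ≤ 1 := by
    have a := pow_le_of_le_one h0 (by linarith) (by lia : q ≠ 0)
    have b := pow_le_of_le_one (by linarith : 0 ≤ 1 - ε) (by linarith) (by lia : q ≠ 0)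
    linarith
  have hpos : 0 ≤ ε ^ q + (1 - ε) ^ q :=
    add_nonneg (pow_nonneg h0 q) (pow_nonneg (by linarith) q)
  have hq' : (2 : ℝ) ≤ q := by exact_mod_cast hq
  have := mul_nonpos_of_nonneg_of_nonpos (one_div_nonneg.2 (by linarith : (0 : ℝ) ≤ q - 1))
    (Real.logb_nonpos one_lt_two hpos hle)
  unfold sampleProb
  linarith

lemma two_point_inequality {q : ℕ} (hq : 2 ≤ q) {ε : ℝ} (h0 : 0 ≤ ε) (h1 : ε ≤ 1 / 2)
    {a b : ℝ} (ha : 0 ≤ a) (hb : 0 ≤ b) :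
    (((1 - ε) * a + ε * b) ^ q + ((1 - ε) * b + ε * a) ^ q) / 2 ≤
      (((a + b) / 2) ^ q) ^ (1 - sampleProb q ε) * ((a ^ q + b ^ q) / 2) ^ sampleProb q ε := by
  wlog hba : b ≤ a generalizing a b
  · have := this hb ha (by linarith)
    rwa [add_comm b a, add_comm (b ^ q), add_comm (((1 - ε) * b + ε * a) ^ q)] at this
  rcases ha.eq_or_lt with rfl | ha'
  · obtain rfl : b = 0 := le_antisymm hba hb
    simp only [mul_zero, add_zero, zero_pow (by lia : q ≠ 0), zero_div]
    positivity
  obtain ⟨c, s, hc, hs0, hs1, rfl, rfl⟩ : ∃ c s : ℝ, 0 < c ∧ 0 ≤ s ∧ s ≤ 1 ∧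
      a = c * (1 + s) ∧ b = c * (1 - s) := by
    have : 0 < a + b := by linarith
    refine ⟨(a + b) / 2, (a - b) / (a + b), by linarith, div_nonneg (by linarith) this.le,
      (div_le_one this).2 (by linarith), ?_, ?_⟩ <;> field_simp <;> ring
  have hr0 : 0 ≤ 1 - 2 * ε := by linarith
  have hr1 : 1 - 2 * ε ≤ 1 := by linarith
  have key : Real.log (evenPow q ((1 - 2 * ε) * s)) ≤
      sampleProb q ε * Real.log (evenPow q s) := by
    have h := log_evenPow_mul_le hq hr0 hr1 hs0 hs1
    rw [log_evenPow_noise hq h0 h1] at h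
    exact le_of_mul_le_mul_right (by linarith) (log_evenPow_one_pos hq)
  have hP : 0 < evenPow q s := by linarith [one_le_evenPow q hs0 hs1]
  have hPr : 0 < evenPow q ((1 - 2 * ε) * s) := by
    linarith [one_le_evenPow q (mul_nonneg hr0 hs0) (mul_le_one₀ hr1 hs0 hs1)]
  have key' : evenPow q ((1 - 2 * ε) * s) ≤ evenPow q s ^ sampleProb q ε := by
    rw [Real.rpow_def_of_pos hP, ← Real.log_le_iff_le_exp hPr]
    linarith
  have e1 : (((1 - ε) * (c * (1 + s)) + ε * (c * (1 - s))) ^ q +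
      ((1 - ε) * (c * (1 - s)) + ε * (c * (1 + s))) ^ q) / 2 =
      c ^ q * evenPow q ((1 - 2 * ε) * s) := by
    rw [evenPow, show (1 - ε) * (c * (1 + s)) + ε * (c * (1 - s)) =
      c * (1 + (1 - 2 * ε) * s) by ring, show (1 - ε) * (c * (1 - s)) + ε * (c * (1 + s)) =
      c * (1 - (1 - 2 * ε) * s) by ring, mul_pow, mul_pow]
    ring
  have e2 : ((c * (1 + s)) ^ q + (c * (1 - s)) ^ q) / 2 = c ^ q * evenPow q s := by
    rw [evenPow, mul_pow, mul_pow]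
    ring
  rw [e1, e2, show (c * (1 + s) + c * (1 - s)) / 2 = c by ring,
    Real.mul_rpow (by positivity) hP.le, ← mul_assoc, ← Real.rpow_add (by positivity),
    sub_add_cancel, Real.rpow_one]
  exact mul_le_mul_of_nonneg_left key' (by positivity)

lemma sum_rpow_mul_rpow_le {ι : Type*} (s : Finset ι) {u v : ι → ℝ} (hu : ∀ i ∈ s, 0 ≤ u i)
    (hv : ∀ i ∈ s, 0 ≤ v i) (hU : 0 < ∑ i ∈ s, u i) (hV : 0 < ∑ i ∈ s, v i) {t : ℝ}
    (ht0 : 0 ≤ t) (ht1 : t ≤ 1) :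
    ∑ i ∈ s, u i ^ (1 - t) * v i ^ t ≤ (∑ i ∈ s, u i) ^ (1 - t) * (∑ i ∈ s, v i) ^ t := by
  set U := ∑ i ∈ s, u i with hUdef
  set V := ∑ i ∈ s, v i with hVdef
  have hpt : ∀ i ∈ s, u i ^ (1 - t) * v i ^ t ≤
      (U ^ (1 - t) * V ^ t) * ((1 - t) * (u i / U) + t * (v i / V)) := fun i hi => by
    have h := Real.geom_mean_le_arith_mean2_weighted (by linarith : 0 ≤ 1 - t) ht0
      (div_nonneg (hu i hi) hU.le) (div_nonneg (hv i hi) hV.le) (by ring)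
    have hpos : 0 ≤ U ^ (1 - t) * V ^ t := by positivity
    refine le_of_eq_of_le ?_ (mul_le_mul_of_nonneg_left h hpos)
    rw [Real.div_rpow (hu i hi) hU.le, Real.div_rpow (hv i hi) hV.le]
    have := Real.rpow_pos_of_pos hU (1 - t)
    have := Real.rpow_pos_of_pos hV t
    field_simp
  refine (Finset.sum_le_sum hpt).trans_eq ?_
  rw [← Finset.mul_sum, Finset.sum_add_distrib, ← Finset.mul_sum, ← Finset.mul_sum,
    ← Finset.sum_div, ← Finset.sum_div, ← hUdef, ← hVdef, div_self hU.ne', div_self hV.ne']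
  ring

lemma sum_noise_pow_le {ι : Type*} [Fintype ι] (σ : Equiv.Perm ι) (hσ : ∀ x, σ (σ x) = x)
    {q : ℕ} (hq : 2 ≤ q) {ε : ℝ} (h0 : 0 ≤ ε) (h1 : ε ≤ 1 / 2) {g : ι → ℝ}
    (hg : ∀ x, 0 ≤ g x) (hpos : 0 < ∑ x, g x ^ q) :
    ∑ x, ((1 - ε) * g x + ε * g (σ x)) ^ q ≤
      (∑ x, ((g x + g (σ x)) / 2) ^ q) ^ (1 - sampleProb q ε) *
        (∑ x, g x ^ q) ^ sampleProb q ε := by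
  have hsymm : ∀ h : ι → ℝ, ∑ x, h x = ∑ x, (h x + h (σ x)) / 2 := fun h => by
    rw [← Finset.sum_div, Finset.sum_add_distrib, Equiv.sum_comp σ h]
    ring
  have hpos' : 0 < ∑ x, ((g x + g (σ x)) / 2) ^ q := by
    obtain ⟨x, -, hx⟩ := Finset.exists_lt_of_sum_lt (s := Finset.univ) (f := fun _ => (0 : ℝ))
      (by simpa using hpos)
    have hx' : 0 < g x := (hg x).lt_of_ne fun h => by
      simp [← h, zero_pow (by lia : q ≠ 0)] at hx
    refine Finset.sum_pos' (fun y _ => pow_nonneg (by linarith [hg y, hg (σ y)]) q)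
      ⟨x, Finset.mem_univ x, pow_pos (by linarith [hg (σ x)]) q⟩
  rw [hsymm fun x => ((1 - ε) * g x + ε * g (σ x)) ^ q]
  rw [hsymm fun x => g x ^ q] at hpos ⊢
  refine le_trans (Finset.sum_le_sum fun x _ => ?_) (sum_rpow_mul_rpow_le Finset.univ
    (fun x _ => pow_nonneg (by linarith [hg x, hg (σ x)]) q)
    (fun x _ => div_nonneg (add_nonneg (pow_nonneg (hg x) q) (pow_nonneg (hg _) q)) two_pos.le)
    hpos' hpos (sampleProb_nonneg hq h0 h1) (sampleProb_le_one hq h0 h1))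
  simp only [hσ]
  exact two_point_inequality hq h0 h1 (hg x) (hg (σ x))

/-- The weight with which a product noise of rates `w` moves `x` to `y`. -/
noncomputable def noiseWeight {n : ℕ} (w : Fin n → ℝ) (x y : Fin n → Bool) : ℝ :=
  ∏ i, if x i = y i then 1 - w i else w i

/-- Product noise: the coordinate `i` is flipped with probability `w i`. -/
noncomputable def prodNoise {n : ℕ} (w : Fin n → ℝ) (f : (Fin n → Bool) → ℝ) :
    (Fin n → Bool) → ℝ :=
  fun x => ∑ y, noiseWeight w x y * f y

lemma noiseWeight_comm {n : ℕ} (w : Fin n → ℝ) (x y : Fin n → Bool) :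
    noiseWeight w x y = noiseWeight w y x := by
  simp only [noiseWeight, eq_comm]

lemma sum_noiseWeight {n : ℕ} (w : Fin n → ℝ) (x : Fin n → Bool) :
    ∑ y, noiseWeight w x y = 1 := by
  have h := Finset.prod_univ_sum (fun _ : Fin n => (Finset.univ : Finset Bool))
    (fun i b => if x i = b then 1 - w i else w i)
  rw [Fintype.piFinset_univ] at h
  simp only [noiseWeight]
  rw [← h]
  refine Finset.prod_eq_one fun i _ => ?_
  cases x i <;> simp

lemma noiseWeight_nonneg {n : ℕ} {w : Fin n → ℝ} (hw0 : ∀ i, 0 ≤ w i) (hw1 : ∀ i, w i ≤ 1)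
    (x y : Fin n → Bool) : 0 ≤ noiseWeight w x y :=
  Finset.prod_nonneg fun i _ => by split_ifs <;> linarith [hw0 i, hw1 i]

lemma noiseWeight_update {n : ℕ} (w : Fin n → ℝ) (i : Fin n) (t : ℝ) (x y : Fin n → Bool) :
    noiseWeight (Function.update w i t) x y = (if x i = y i then 1 - t else t) *
      ∏ j ∈ Finset.univ.erase i, if x j = y j then 1 - w j else w j := by
  rw [noiseWeight, ← Finset.mul_prod_erase _ _ (Finset.mem_univ i), Function.update_self]
  congr 1
  exact Finset.prod_congr rfl fun j hj => by rw [Function.update_of_ne (Finset.ne_of_mem_erase hj)]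

/-- Flipping the `i`-th coordinate. -/
def flipAt {n : ℕ} (i : Fin n) : Equiv.Perm (Fin n → Bool) :=
  Function.Involutive.toPerm (fun x => Function.update x i (!x i)) fun x => by simp

lemma flipAt_apply {n : ℕ} (i : Fin n) (x : Fin n → Bool) :
    flipAt i x = Function.update x i (!x i) := rfl

lemma flipAt_flipAt {n : ℕ} (i : Fin n) (x : Fin n → Bool) : flipAt i (flipAt i x) = x := by
  simp [flipAt_apply]

lemma prodNoise_update {n : ℕ} (w : Fin n → ℝ) (i : Fin n) (t : ℝ)
    (f : (Fin n → Bool) → ℝ) (x : Fin n → Bool) :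
    prodNoise (Function.update w i t) f x =
      (1 - t) * prodNoise (Function.update w i 0) f x +
        t * prodNoise (Function.update w i 0) f (flipAt i x) := by
  simp only [prodNoise, Finset.mul_sum, ← Finset.sum_add_distrib]
  refine Finset.sum_congr rfl fun y _ => ?_
  have hprod : ∏ j ∈ Finset.univ.erase i, (if flipAt i x j = y j then 1 - w j else w j) =
      ∏ j ∈ Finset.univ.erase i, if x j = y j then 1 - w j else w j :=
    Finset.prod_congr rfl fun j hj => by
      rw [flipAt_apply, Function.update_of_ne (Finset.ne_of_mem_erase hj)]
  rw [noiseWeight_update, noiseWeight_update, noiseWeight_update, hprod, flipAt_apply,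
    Function.update_self]
  cases x i <;> cases y i <;> simp <;> ring

lemma prodNoise_nonneg {n : ℕ} {w : Fin n → ℝ} (hw0 : ∀ i, 0 ≤ w i) (hw1 : ∀ i, w i ≤ 1)
    {f : (Fin n → Bool) → ℝ} (hf : ∀ x, 0 ≤ f x) (x : Fin n → Bool) : 0 ≤ prodNoise w f x :=
  Finset.sum_nonneg fun y _ => mul_nonneg (noiseWeight_nonneg hw0 hw1 x y) (hf y)

lemma sum_prodNoise {n : ℕ} (w : Fin n → ℝ) (f : (Fin n → Bool) → ℝ) :
    ∑ x, prodNoise w f x = ∑ x, f x := by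
  simp only [prodNoise]
  rw [Finset.sum_comm]
  refine Finset.sum_congr rfl fun y _ => ?_
  rw [← Finset.sum_mul]
  simp only [noiseWeight_comm w _ y, sum_noiseWeight, one_mul]

lemma sum_prodNoise_pow_pos {n : ℕ} {w : Fin n → ℝ} (hw0 : ∀ i, 0 ≤ w i) (hw1 : ∀ i, w i ≤ 1)
    {f : (Fin n → Bool) → ℝ} (hf : ∀ x, 0 ≤ f x) (hf0 : f ≠ 0) (q : ℕ) :
    0 < ∑ x, prodNoise w f x ^ q := by
  obtain ⟨z, hz⟩ := Function.ne_iff.1 hf0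
  have h : 0 < ∑ x, prodNoise w f x := by
    rw [sum_prodNoise]
    exact Finset.sum_pos' (fun x _ => hf x) ⟨z, Finset.mem_univ z, (hf z).lt_of_ne' hz⟩
  obtain ⟨x, -, hx⟩ := Finset.exists_lt_of_sum_lt (s := Finset.univ) (f := fun _ => (0 : ℝ))
    (by simpa using h)
  exact Finset.sum_pos' (fun y _ => pow_nonneg (prodNoise_nonneg hw0 hw1 hf y) q)
    ⟨x, Finset.mem_univ x, pow_pos hx q⟩

lemma log_lqNorm {n q : ℕ} {g : (Fin n → Bool) → ℝ} (hg : ∀ x, 0 ≤ g x)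
    (hpos : 0 < ∑ x, g x ^ q) :
    Real.log (lqNorm q g) =
      1 / q * (Real.log ((2 ^ n)⁻¹) + Real.log (∑ x, g x ^ q)) := by
  simp only [lqNorm, abs_of_nonneg (hg _)]
  rw [Real.log_rpow (by positivity), Real.log_mul (by positivity) hpos.ne']

lemma log_lqNorm_prodNoise_le {n : ℕ} {q : ℕ} (hq : 2 ≤ q) {ε : ℝ} (h0 : 0 ≤ ε)
    (h1 : ε ≤ 1 / 2) {w : Fin n → ℝ} (hw0 : ∀ i, 0 ≤ w i) (hw1 : ∀ i, w i ≤ 1) (i : Fin n)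
    (hwi : w i = ε) {f : (Fin n → Bool) → ℝ} (hf : ∀ x, 0 ≤ f x) (hf0 : f ≠ 0) :
    Real.log (lqNorm q (prodNoise w f)) ≤
      (1 - sampleProb q ε) *
          Real.log (lqNorm q (prodNoise (Function.update w i (1 / 2)) f)) +
        sampleProb q ε * Real.log (lqNorm q (prodNoise (Function.update w i 0) f)) := by
  have hu0 : ∀ t : ℝ, 0 ≤ t → ∀ j, 0 ≤ Function.update w i t j := fun t ht j => by
    rw [Function.update_apply]; split_ifs <;> simp [ht, hw0]
  have hu1 : ∀ t : ℝ, t ≤ 1 → ∀ j, Function.update w i t j ≤ 1 := fun t ht j => by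
    rw [Function.update_apply]; split_ifs <;> simp [ht, hw1]
  have half0 : (0 : ℝ) ≤ 1 / 2 := by norm_num
  have half1 : (1 / 2 : ℝ) ≤ 1 := by norm_num
  have pE := sum_prodNoise_pow_pos (hu0 _ half0) (hu1 _ half1) hf hf0 q
  have p0 := sum_prodNoise_pow_pos (hu0 0 le_rfl) (hu1 0 zero_le_one) hf hf0 q
  have pw := sum_prodNoise_pow_pos hw0 hw1 hf hf0 q
  rw [log_lqNorm (prodNoise_nonneg hw0 hw1 hf) pw,
    log_lqNorm (prodNoise_nonneg (hu0 _ half0) (hu1 _ half1) hf) pE,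
    log_lqNorm (prodNoise_nonneg (hu0 0 le_rfl) (hu1 0 zero_le_one) hf) p0]
  have h := sum_noise_pow_le (flipAt i) (flipAt_flipAt i) hq h0 h1
    (prodNoise_nonneg (hu0 0 le_rfl) (hu1 0 zero_le_one) hf) p0
  simp only [← prodNoise_update] at h
  have hhalf : ∀ x, (prodNoise (Function.update w i 0) f x +
      prodNoise (Function.update w i 0) f (flipAt i x)) / 2 =
      prodNoise (Function.update w i (1 / 2)) f x := fun x => by
    rw [prodNoise_update w i (1 / 2)]; ring
  simp only [hhalf] at h
  rw [← hwi, Function.update_eq_self, hwi] at h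
  have hlog := Real.log_le_log pw h
  rw [Real.log_mul (by positivity) (by positivity), Real.log_rpow pE, Real.log_rpow p0] at hlog
  have hq0 : (0 : ℝ) ≤ 1 / q := by positivity
  refine (mul_le_mul_of_nonneg_left (add_le_add_right hlog _) hq0).trans_eq ?_
  ring

/-- The rates `w`, replaced by `0` on `R` and by `1 / 2` on the rest of `S`. -/
noncomputable def condRates {n : ℕ} (w : Fin n → ℝ) (S R : Finset (Fin n)) : Fin n → ℝ :=
  fun i => if i ∈ R then 0 else if i ∈ S then 1 / 2 else w i

lemma log_lqNorm_prodNoise_le_sum {n : ℕ} {q : ℕ} (hq : 2 ≤ q) {ε : ℝ} (h0 : 0 ≤ ε)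
    (h1 : ε ≤ 1 / 2) {f : (Fin n → Bool) → ℝ} (hf : ∀ x, 0 ≤ f x) (hf0 : f ≠ 0)
    (S : Finset (Fin n)) :
    Real.log (lqNorm q (prodNoise (fun _ => ε) f)) ≤
      ∑ R ∈ S.powerset, sampleProb q ε ^ R.card * (1 - sampleProb q ε) ^ (S.card - R.card) *
        Real.log (lqNorm q (prodNoise (condRates (fun _ => ε) S R) f)) := by
  have hl0 := sampleProb_nonneg hq h0 h1
  have hl1 := sampleProb_le_one hq h0 h1
  induction S using Finset.induction_on with
  | empty =>
    have h : condRates (fun _ => ε) (∅ : Finset (Fin n)) ∅ = fun _ => ε := by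
      funext i
      simp [condRates]
    simp [h]
  | insert a S ha ih =>
    refine ih.trans ?_
    rw [Finset.sum_powerset_insert ha, ← Finset.sum_add_distrib]
    refine Finset.sum_le_sum fun R hR => ?_
    have hRS := Finset.mem_powerset.1 hR
    have haR : a ∉ R := fun h => ha (hRS h)
    have hc := Finset.card_le_card hRS
    have hw0 : ∀ i, 0 ≤ condRates (fun _ => ε) S R i := fun i => by
      unfold condRates; split_ifs <;> linarith
    have hw1 : ∀ i, condRates (fun _ => ε) S R i ≤ 1 := fun i => by
      unfold condRates; split_ifs <;> linarith
    have hstep := log_lqNorm_prodNoise_le hq h0 h1 hw0 hw1 a (by simp [condRates, ha, haR]) hf hf0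
    have e1 : Function.update (condRates (fun _ => ε) S R) a (1 / 2) =
        condRates (fun _ => ε) (insert a S) R := by
      funext i
      by_cases hi : i = a
      · subst hi; simp [condRates, haR]
      · simp [condRates, hi]
    have e2 : Function.update (condRates (fun _ => ε) S R) a 0 =
        condRates (fun _ => ε) (insert a S) (insert a R) := by
      funext i
      by_cases hi : i = a
      · subst hi; simp [condRates]
      · simp [condRates, hi]
    rw [e1, e2] at hstep
    rw [Finset.card_insert_of_notMem ha, Finset.card_insert_of_notMem haR,
      Nat.add_sub_add_right, show S.card + 1 - R.card = S.card - R.card + 1 by lia]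
    have hw : 0 ≤ sampleProb q ε ^ R.card * (1 - sampleProb q ε) ^ (S.card - R.card) :=
      mul_nonneg (pow_nonneg hl0 _) (pow_nonneg (by linarith) _)
    refine (mul_le_mul_of_nonneg_left hstep hw).trans_eq ?_
    ring

lemma noiseOp_eq_prodNoise {n : ℕ} (ε : ℝ) (f : (Fin n → Bool) → ℝ) :
    noiseOp ε f = prodNoise (fun _ => ε) f := by
  funext x
  refine Finset.sum_congr rfl fun y _ => ?_
  have hcard := Finset.card_filter_add_card_filter_not (s := (Finset.univ : Finset (Fin n)))
    (fun i => x i = y i)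
  rw [Finset.card_univ, Fintype.card_fin] at hcard
  rw [noiseWeight, Finset.prod_ite, Finset.prod_const, Finset.prod_const, hamDist,
    mul_comm (_ ^ _)]
  simp only [ne_eq]
  congr 3
  lia

lemma noiseWeight_condRates {n : ℕ} (w : Fin n → ℝ) (T : Finset (Fin n)) (x y : Fin n → Bool) :
    noiseWeight (condRates w Finset.univ T) x y =
      if ∀ i ∈ T, y i = x i then (1 / 2) ^ (n - T.card) else 0 := by
  split_ifs with h
  · have : ∀ i, (if x i = y i then 1 - condRates w Finset.univ T i
        else condRates w Finset.univ T i) = if i ∈ T then 1 else (1 / 2 : ℝ) := fun i => by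
      by_cases hi : i ∈ T
      · simp [condRates, hi, h i hi]
      · simp only [condRates, hi, Finset.mem_univ, if_true, if_false]
        split_ifs <;> norm_num
    simp only [noiseWeight, this]
    rw [Finset.prod_ite, Finset.prod_const_one, one_mul, Finset.prod_const,
      Finset.filter_notMem_eq_sdiff, Finset.card_sdiff_of_subset (Finset.subset_univ T),
      Finset.card_univ, Fintype.card_fin]
  · push Not at h
    obtain ⟨i, hi, hne⟩ := h
    exact Finset.prod_eq_zero (Finset.mem_univ i) (by simp [condRates, hi, hne.symm])

lemma condExp_eq_prodNoise {n : ℕ} (w : Fin n → ℝ) (f : (Fin n → Bool) → ℝ)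
    (T : Finset (Fin n)) : condExp f T = prodNoise (condRates w Finset.univ T) f := by
  funext x
  have hsum := sum_noiseWeight (condRates w Finset.univ T) x
  simp only [noiseWeight_condRates] at hsum
  rw [← Finset.sum_filter, Finset.sum_const, nsmul_eq_mul] at hsum
  simp only [prodNoise, noiseWeight_condRates, ite_mul, zero_mul]
  rw [← Finset.sum_filter, ← Finset.mul_sum, condExp, div_eq_inv_mul,
    inv_eq_of_mul_eq_one_right hsum]

/-- **Theorem (main inequality, scalar noise).** For integer `q ≥ 2`, `0 ≤ ε ≤ 1/2`, and
`λ = 1 + (1/(q-1))·log₂(ε^q + (1-ε)^q)`, for every nonnegative `f ≢ 0` on `{0,1}^n`,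
`log ‖T_ε f‖_q ≤ E_{T∼λ} log ‖E(f|T)‖_q`. -/
theorem noise_lq_le_avg_condExp (n : ℕ) (hn : 1 ≤ n) (q : ℕ) (hq : 2 ≤ q)
    (ε : ℝ) (hε0 : 0 ≤ ε) (hε1 : ε ≤ 1 / 2)
    (f : (Fin n → Bool) → ℝ) (hf : ∀ x, 0 ≤ f x) (hf0 : f ≠ 0) :
    Real.log (lqNorm q (noiseOp ε f)) ≤
      ∑ T : Finset (Fin n),
        (1 + 1 / ((q : ℝ) - 1) * Real.logb 2 (ε ^ q + (1 - ε) ^ q)) ^ T.card *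
          (1 - (1 + 1 / ((q : ℝ) - 1) * Real.logb 2 (ε ^ q + (1 - ε) ^ q))) ^ (n - T.card) *
          Real.log (lqNorm q (condExp f T)) := by
  rw [noiseOp_eq_prodNoise]
  refine (log_lqNorm_prodNoise_le_sum hq hε0 hε1 hf hf0 Finset.univ).trans_eq ?_
  rw [Finset.powerset_univ, Finset.card_univ, Fintype.card_fin]
  exact Finset.sum_congr rfl fun T _ => by rw [condExp_eq_prodNoise fun _ => ε, sampleProb]
end

section
/- Let q ≥ 2 be an even integer (more generally, any integer q ≥ 2), let 0 ≤ ε ≤ 1/2, and set λ = 1 + (1/(q-1))·log₂(ε^q + (1-ε)^q). Then for every nonnegative function f on {0,1} (the one-dimensional cube), ‖T_ε f‖_q ≤ ‖f‖_1^{1-λ} · ‖f‖_q^{λ}. -/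
open Set

/-- The sum `(1 + t) ^ n + (1 - t) ^ n`. -/
def powSum (n : ℕ) (t : ℝ) : ℝ := (1 + t) ^ n + (1 - t) ^ n

/-- The difference `(1 + t) ^ n - (1 - t) ^ n`. -/
def powDiff (n : ℕ) (t : ℝ) : ℝ := (1 + t) ^ n - (1 - t) ^ n

/-- The polynomial `powDiff n t / t`, defined by recursion on `n`. -/
def powDiffQuot : ℕ → ℝ → ℝ
  | 0, _ => 0
  | n + 1, t => powDiffQuot n t + powSum n t

theorem powSum_succ (n : ℕ) (t : ℝ) : powSum (n + 1) t = powSum n t + t * powDiff n t := by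
  simp only [powSum, powDiff]; ring

theorem powDiff_succ (n : ℕ) (t : ℝ) : powDiff (n + 1) t = powDiff n t + t * powSum n t := by
  simp only [powSum, powDiff]; ring

theorem powDiffQuot_succ (n : ℕ) (t : ℝ) :
    powDiffQuot (n + 1) t = powDiffQuot n t + powSum n t := rfl

theorem mul_powDiffQuot (n : ℕ) (t : ℝ) : t * powDiffQuot n t = powDiff n t := by
  induction n with
  | zero => simp [powDiffQuot, powDiff]
  | succ n ih => rw [powDiffQuot_succ, powDiff_succ, mul_add, ih]

theorem hasDerivAt_powSum (n : ℕ) (t : ℝ) :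
    HasDerivAt (powSum (n + 1)) ((n + 1) * powDiff n t) t := by
  have h := (((hasDerivAt_id t).const_add 1).pow (n + 1)).add
    (((hasDerivAt_id t).const_sub 1).pow (n + 1))
  refine h.congr_deriv ?_
  simp only [powDiff, id, Nat.add_sub_cancel, Nat.cast_add, Nat.cast_one]
  ring

theorem hasDerivAt_powDiff (n : ℕ) (t : ℝ) :
    HasDerivAt (powDiff (n + 1)) ((n + 1) * powSum n t) t := by
  have h := (((hasDerivAt_id t).const_add 1).pow (n + 1)).sub
    (((hasDerivAt_id t).const_sub 1).pow (n + 1))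
  refine h.congr_deriv ?_
  simp only [powSum, id, Nat.add_sub_cancel, Nat.cast_add, Nat.cast_one]
  ring

theorem powSum_pos (n : ℕ) {t : ℝ} (h0 : 0 ≤ t) (h1 : t ≤ 1) : 0 < powSum n t := by
  have : 0 ≤ (1 - t) ^ n := pow_nonneg (by linarith) n
  unfold powSum; positivity

theorem powDiff_nonneg (n : ℕ) {t : ℝ} (h0 : 0 ≤ t) (h1 : t ≤ 1) : 0 ≤ powDiff n t :=
  sub_nonneg.2 (pow_le_pow_left₀ (by linarith) (by linarith) n)

theorem powDiff_succ_pos (n : ℕ) {t : ℝ} (h0 : 0 < t) (h1 : t ≤ 1) : 0 < powDiff (n + 1) t :=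
  sub_pos.2 (pow_lt_pow_left₀ (by linarith) (by linarith) n.succ_ne_zero)

theorem powDiff_le_powDiff (n : ℕ) {s t : ℝ} (hs : 0 ≤ s) (hst : s ≤ t) (ht : t ≤ 1) :
    powDiff n s ≤ powDiff n t :=
  sub_le_sub (pow_le_pow_left₀ (by linarith) (by linarith) n)
    (pow_le_pow_left₀ (by linarith) (by linarith) n)

theorem powSum_le_powSum (n : ℕ) {s t : ℝ} (hs : 0 ≤ s) (hst : s ≤ t) (ht : t ≤ 1) :
    powSum n s ≤ powSum n t := by
  induction n with
  | zero => simp [powSum]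
  | succ n ih =>
    rw [powSum_succ, powSum_succ]
    exact add_le_add ih (mul_le_mul hst (powDiff_le_powDiff n hs hst ht)
      (powDiff_nonneg n hs (hst.trans ht)) (hs.trans hst))

theorem powDiffQuot_le_powDiffQuot (n : ℕ) {s t : ℝ} (hs : 0 ≤ s) (hst : s ≤ t) (ht : t ≤ 1) :
    powDiffQuot n s ≤ powDiffQuot n t := by
  induction n with
  | zero => simp [powDiffQuot]
  | succ n ih =>
    rw [powDiffQuot_succ, powDiffQuot_succ]
    exact add_le_add ih (powSum_le_powSum n hs hst ht)

/-- The logarithmic derivative of `t * powDiff (k + 1) t / powSum (k + 2) t`, times `t`. -/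
noncomputable def logDerivRatio (k : ℕ) (t : ℝ) : ℝ :=
  powSum (k + 1) t / powSum (k + 2) t +
    4 * (k + 1) * (1 - t ^ 2) ^ k / (powSum (k + 2) t * powDiffQuot (k + 1) t)

theorem powSum_div_powSum_succ_le (n : ℕ) {s t : ℝ} (hs : 0 ≤ s) (hst : s ≤ t) (ht : t ≤ 1) :
    powSum n t / powSum (n + 1) t ≤ powSum n s / powSum (n + 1) s := by
  have ht0 := hs.trans hst
  have hs1 := hst.trans ht
  rw [div_le_div_iff₀ (powSum_pos _ ht0 ht) (powSum_pos _ hs hs1), powSum_succ, powSum_succ]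
  have key : powDiff n s * powSum n t ≤ powDiff n t * powSum n s := by
    have h : ((1 + s) * (1 - t)) ^ n ≤ ((1 + t) * (1 - s)) ^ n :=
      pow_le_pow_left₀ (mul_nonneg (by linarith) (by linarith)) (by nlinarith) n
    rw [mul_pow, mul_pow] at h
    simp only [powDiff, powSum]
    nlinarith
  have h2 : s * (powDiff n s * powSum n t) ≤ t * (powDiff n t * powSum n s) :=
    mul_le_mul hst key (mul_nonneg (powDiff_nonneg n hs hs1) (powSum_pos n ht0 ht).le) ht0
  nlinarith

theorem logDerivRatio_le (k : ℕ) {s t : ℝ} (hs : 0 < s) (hst : s ≤ t) (ht : t ≤ 1) :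
    logDerivRatio k t ≤ logDerivRatio k s := by
  have hs1 := hst.trans ht
  have hQ : 0 < powDiffQuot (k + 1) s := by
    have := powDiff_succ_pos k hs hs1
    rw [← mul_powDiffQuot] at this
    exact pos_of_mul_pos_right this hs.le
  have hS := powSum_pos (k + 2) hs.le hs1
  refine add_le_add (powSum_div_powSum_succ_le _ hs.le hst ht) (div_le_div₀ ?_ ?_ ?_ ?_)
  · exact mul_nonneg (by positivity) (pow_nonneg (by nlinarith) k)
  · exact mul_le_mul_of_nonneg_left (pow_le_pow_left₀ (by nlinarith) (by nlinarith) k)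
      (by positivity)
  · positivity
  · exact mul_le_mul (powSum_le_powSum _ hs.le hst ht)
      (powDiffQuot_le_powDiffQuot _ hs.le hst ht) hQ.le (hS.le.trans
      (powSum_le_powSum _ hs.le hst ht))

/-- The function `t * powDiff (k + 1) t / powSum (k + 2) t`, which is up to the factor `k + 2`
the derivative of `log (powSum (k + 2) t)` with respect to `log t`. -/
noncomputable def elasticity (k : ℕ) (t : ℝ) : ℝ := t * powDiff (k + 1) t / powSum (k + 2) t

theorem elasticity_pos (k : ℕ) {t : ℝ} (h0 : 0 < t) (h1 : t ≤ 1) : 0 < elasticity k t :=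
  div_pos (mul_pos h0 (powDiff_succ_pos k h0 h1)) (powSum_pos _ h0.le h1)

theorem hasDerivAt_log_elasticity (k : ℕ) {t : ℝ} (h0 : 0 < t) (h1 : t ≤ 1) :
    HasDerivAt (fun x => Real.log (elasticity k x)) (logDerivRatio k t / t) t := by
  have hD := powDiff_succ_pos k h0 h1
  have hS := powSum_pos (k + 2) h0.le h1
  have h := ((((hasDerivAt_id t).mul (hasDerivAt_powDiff k t)).div (hasDerivAt_powSum (k + 1) t)
    hS.ne').log (elasticity_pos k h0 h1).ne')
  refine h.congr_deriv ?_
  have hQ : 0 < powDiffQuot (k + 1) t := by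
    rw [← mul_powDiffQuot] at hD
    exact pos_of_mul_pos_right hD h0.le
  have hQt : powDiffQuot (k + 1) t = powDiff (k + 1) t / t := by
    rw [← mul_powDiffQuot, mul_div_cancel_left₀ _ h0.ne']
  have key : powSum (k + 2) t * powDiff (k + 1) t + (k + 1) * t * powSum k t * powSum (k + 2) t
      - (k + 2) * t * powDiff (k + 1) t ^ 2 =
      powSum (k + 1) t * powDiff (k + 1) t + 4 * (k + 1) * t * (1 - t ^ 2) ^ k := by
    have : (1 - t ^ 2) ^ k = (1 + t) ^ k * (1 - t) ^ k := by rw [← mul_pow]; ring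
    rw [this]
    simp only [powSum, powDiff]
    ring
  simp only [logDerivRatio, hQt, id, Pi.mul_apply, Pi.div_apply, Nat.cast_add, Nat.cast_one]
  field_simp
  linear_combination key

theorem elasticity_mul_le (k : ℕ) {c s t : ℝ} (hc0 : 0 < c) (hc1 : c ≤ 1) (hs : 0 < s)
    (hst : s ≤ t) (ht : t < 1) :
    elasticity k (c * s) * elasticity k t ≤ elasticity k (c * t) * elasticity k s := by
  have hd : ∀ x ∈ Ioo (0 : ℝ) 1, HasDerivAt
      (fun x => Real.log (elasticity k (c * x)) - Real.log (elasticity k x))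
      (logDerivRatio k (c * x) / (c * x) * c - logDerivRatio k x / x) x := by
    intro x hx
    have hcx : 0 < c * x := mul_pos hc0 hx.1
    have hcx1 : c * x ≤ 1 := mul_le_one₀ hc1 hx.1.le hx.2.le
    have h1 : HasDerivAt (fun y => c * y) c x := by
      simpa using (hasDerivAt_id x).const_mul c
    exact ((hasDerivAt_log_elasticity k hcx hcx1).comp x h1).sub
      (hasDerivAt_log_elasticity k hx.1 hx.2.le)
  have hm : MonotoneOn (fun x => Real.log (elasticity k (c * x)) - Real.log (elasticity k x))
      (Ioo 0 1) := by
    refine monotoneOn_of_deriv_nonneg (convex_Ioo 0 1)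
      (fun x hx => (hd x hx).continuousAt.continuousWithinAt)
      (fun x hx => (hd x (interior_subset hx)).differentiableAt.differentiableWithinAt) ?_
    intro x hx
    replace hx := interior_subset hx
    rw [(hd x hx).deriv]
    have hle := logDerivRatio_le k (mul_pos hc0 hx.1) (mul_le_of_le_one_left hx.1.le hc1) hx.2.le
    have hx0 := hx.1
    have : logDerivRatio k (c * x) / (c * x) * c - logDerivRatio k x / x =
        (logDerivRatio k (c * x) - logDerivRatio k x) / x := by
      field_simp
    rw [this]
    exact div_nonneg (sub_nonneg.2 hle) hx0.le
  have h := hm ⟨hs, hst.trans_lt ht⟩ ⟨hs.trans_le hst, ht⟩ hst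
  have ht0 := hs.trans_le hst
  have hs1 := hst.trans ht.le
  have e1 := elasticity_pos k hs hs1
  have e2 := elasticity_pos k ht0 ht.le
  have e3 := elasticity_pos k (mul_pos hc0 hs) (mul_le_one₀ hc1 hs.le hs1)
  have e4 := elasticity_pos k (mul_pos hc0 ht0) (mul_le_one₀ hc1 ht0.le ht.le)
  rw [← Real.log_le_log_iff (by positivity) (by positivity), Real.log_mul e3.ne' e2.ne',
    Real.log_mul e4.ne' e1.ne']
  simp only at h
  linarith

/-- The logarithm of the `q`-th moment of the function `(1 + t, 1 - t)`. -/
noncomputable def logMoment (q : ℕ) (t : ℝ) : ℝ := Real.log (powSum q t / 2)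

theorem logMoment_zero (q : ℕ) : logMoment q 0 = 0 := by
  norm_num [logMoment, powSum]

theorem logMoment_one (q : ℕ) (hq : q ≠ 0) : logMoment q 1 = (q - 1) * Real.log 2 := by
  obtain ⟨n, rfl⟩ := Nat.exists_eq_succ_of_ne_zero hq
  have : powSum (n + 1) 1 / 2 = 2 ^ n := by
    simp only [powSum]
    norm_num
    ring
  simp [logMoment, this]

theorem hasDerivAt_logMoment (k : ℕ) {t : ℝ} (h0 : 0 ≤ t) (h1 : t ≤ 1) :
    HasDerivAt (logMoment (k + 2)) ((k + 2) * (powDiff (k + 1) t / powSum (k + 2) t)) t := by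
  have hS := powSum_pos (k + 2) h0 h1
  refine (((hasDerivAt_powSum (k + 1) t).div_const 2).log (by positivity)).congr_deriv ?_
  push_cast
  field_simp
  ring

theorem logMoment_mul_le (k : ℕ) {c t : ℝ} (hc0 : 0 ≤ c) (hc1 : c ≤ 1) (ht0 : 0 ≤ t)
    (ht1 : t ≤ 1) :
    logMoment (k + 2) 1 * logMoment (k + 2) (c * t) ≤
      logMoment (k + 2) c * logMoment (k + 2) t := by
  rcases hc0.eq_or_lt with rfl | hc0
  · simp [logMoment_zero]
  rcases ht0.eq_or_lt with rfl | ht0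
  · simp [logMoment_zero]
  rcases ht1.eq_or_lt with rfl | ht1
  · simp [mul_comm]
  set A := logMoment (k + 2) 1 with hA
  set B := logMoment (k + 2) c with hB
  have hApos : 0 < A := by
    rw [hA, logMoment_one _ (by omega)]
    have := Real.log_pos one_lt_two
    push_cast
    exact mul_pos (by linarith [k.cast_nonneg (α := ℝ)]) this
  set G : ℝ → ℝ := fun x => B * logMoment (k + 2) x - A * logMoment (k + 2) (c * x) with hG
  have hd : ∀ x ∈ Icc (0 : ℝ) 1, HasDerivAt G
      (B * ((k + 2) * (powDiff (k + 1) x / powSum (k + 2) x)) -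
        A * ((k + 2) * (powDiff (k + 1) (c * x) / powSum (k + 2) (c * x)) * c)) x := by
    intro x hx
    have h1 : HasDerivAt (fun y => c * y) c x := by
      simpa using (hasDerivAt_id x).const_mul c
    exact ((hasDerivAt_logMoment k hx.1 hx.2).const_mul B).sub
      (((hasDerivAt_logMoment k (mul_nonneg hc0.le hx.1) (mul_le_one₀ hc1 hx.1 hx.2)).comp x
        h1).const_mul A)
  have hcont : ContinuousOn G (Icc 0 1) := fun x hx => (hd x hx).continuousAt.continuousWithinAt
  have hG0 : G 0 = 0 := by simp [hG, logMoment_zero]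
  have hG1 : G 1 = 0 := by simp [hG, ← hA, ← hB, mul_comm]
  have hder : ∀ x, 0 < x → (B * ((k + 2) * (powDiff (k + 1) x / powSum (k + 2) x)) -
        A * ((k + 2) * (powDiff (k + 1) (c * x) / powSum (k + 2) (c * x)) * c)) =
      (k + 2) / x * (B * elasticity k x - A * elasticity k (c * x)) := by
    intro x hx
    simp only [elasticity]
    field_simp
  by_contra! hlt
  have hGt : G t < 0 := by simp only [hG]; linarith
  obtain ⟨s₁, hs₁, he₁⟩ := exists_hasDerivAt_eq_slope G _ ht0
    (hcont.mono (Icc_subset_Icc_right ht1.le)) (fun x hx => hd x ⟨hx.1.le, hx.2.le.trans ht1.le⟩)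
  obtain ⟨s₂, hs₂, he₂⟩ := exists_hasDerivAt_eq_slope G _ ht1
    (hcont.mono (Icc_subset_Icc_left ht0.le)) (fun x hx => hd x ⟨ht0.le.trans hx.1.le, hx.2.le⟩)
  have hs₂0 := ht0.trans hs₂.1
  have hs₁1 := hs₁.2.trans ht1
  have hs₁0 := hs₁.1
  rw [hder s₁ hs₁.1] at he₁
  rw [hder s₂ hs₂0] at he₂
  have n₁ : B * elasticity k s₁ - A * elasticity k (c * s₁) < 0 := by
    have : (G t - G 0) / (t - 0) < 0 := div_neg_of_neg_of_pos (by linarith) (by linarith)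
    rw [← he₁] at this
    exact (pos_iff_neg_of_mul_neg this).1 (by positivity)
  have n₂ : 0 < B * elasticity k s₂ - A * elasticity k (c * s₂) := by
    have : 0 < (G 1 - G t) / (1 - t) := div_pos (by linarith) (by linarith)
    rw [← he₂] at this
    exact (pos_iff_pos_of_mul_pos this).1 (by positivity)
  have hmono := elasticity_mul_le k hc0 hc1 hs₁0 (hs₁.2.trans hs₂.1).le hs₂.2
  have p₁ := elasticity_pos k hs₁0 hs₁1.le
  have p₂ := elasticity_pos k hs₂0 hs₂.2.le
  have q₁ := mul_neg_of_neg_of_pos n₁ p₂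
  have q₂ := mul_pos n₂ p₁
  have q₃ := mul_le_mul_of_nonneg_left hmono hApos.le
  linarith

/-- The case of the function `(M (1 + t), M (1 - t))`. -/
theorem noise_norm_le_of_mean (q : ℕ) (hq : 2 ≤ q) {ε M t : ℝ} (hε0 : 0 ≤ ε) (hε1 : ε ≤ 1 / 2)
    (hM : 0 < M) (ht0 : 0 ≤ t) (ht1 : t ≤ 1) :
    (M ^ q * (powSum q ((1 - 2 * ε) * t) / 2)) ^ ((1 : ℝ) / q) ≤
      M ^ (1 - (1 + 1 / ((q : ℝ) - 1) * Real.logb 2 (ε ^ q + (1 - ε) ^ q))) *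
        ((M ^ q * (powSum q t / 2)) ^ ((1 : ℝ) / q)) ^
          (1 + 1 / ((q : ℝ) - 1) * Real.logb 2 (ε ^ q + (1 - ε) ^ q)) := by
  obtain ⟨k, rfl⟩ := Nat.exists_eq_add_of_le' hq
  have hc0 : 0 ≤ 1 - 2 * ε := by linarith
  have hc1 : 1 - 2 * ε ≤ 1 := by linarith
  have hmain := logMoment_mul_le k hc0 hc1 ht0 ht1
  have hlog2 := Real.log_pos one_lt_two
  have hε : 0 < ε ^ (k + 2) + (1 - ε) ^ (k + 2) :=
    add_pos_of_nonneg_of_pos (by positivity) (pow_pos (by linarith) _)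
  have hlam : logMoment (k + 2) (1 - 2 * ε) = logMoment (k + 2) 1 *
      (1 + 1 / (((k + 2 : ℕ) : ℝ) - 1) *
        Real.logb 2 (ε ^ (k + 2) + (1 - ε) ^ (k + 2))) := by
    have h1 : powSum (k + 2) (1 - 2 * ε) / 2 =
        2 ^ (k + 1) * (ε ^ (k + 2) + (1 - ε) ^ (k + 2)) := by
      have e1 : 1 + (1 - 2 * ε) = 2 * (1 - ε) := by ring
      have e2 : 1 - (1 - 2 * ε) = 2 * ε := by ring
      simp only [powSum, e1, e2, mul_pow]
      ring
    have hk : (k : ℝ) + 2 - 1 ≠ 0 := by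
      have : (0 : ℝ) ≤ k := k.cast_nonneg
      linarith
    rw [logMoment_one _ (by omega), logMoment, h1, Real.log_mul (by positivity) hε.ne',
      Real.log_pow, Real.logb]
    push_cast
    field_simp
    ring
  set lam := 1 + 1 / (((k + 2 : ℕ) : ℝ) - 1) * Real.logb 2 (ε ^ (k + 2) + (1 - ε) ^ (k + 2))
  have hpos : 0 < logMoment (k + 2) 1 := by
    rw [logMoment_one _ (by omega)]
    push_cast
    exact mul_pos (by linarith [k.cast_nonneg (α := ℝ)]) hlog2
  have hle : logMoment (k + 2) ((1 - 2 * ε) * t) ≤ lam * logMoment (k + 2) t := by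
    rw [hlam, mul_assoc] at hmain
    exact le_of_mul_le_mul_left hmain hpos
  have hS := powSum_pos (k + 2) ht0 ht1
  have hSc := powSum_pos (k + 2) (mul_nonneg hc0 ht0) (mul_le_one₀ hc1 ht0 ht1)
  have hq0 : (0 : ℝ) < ((k + 2 : ℕ) : ℝ) := by positivity
  rw [← Real.log_le_log_iff (by positivity) (by positivity), Real.log_mul (by positivity)
    (by positivity), Real.log_rpow (by positivity), Real.log_rpow hM, Real.log_rpow (by positivity),
    Real.log_rpow (by positivity), Real.log_mul (by positivity) (by positivity),
    Real.log_mul (by positivity) (by positivity), Real.log_pow]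
  change 1 / ((k + 2 : ℕ) : ℝ) * (_ + logMoment (k + 2) ((1 - 2 * ε) * t)) ≤
    _ + lam * (1 / ((k + 2 : ℕ) : ℝ) * (_ + logMoment (k + 2) t))
  have : (1 - lam) * Real.log M + lam * (1 / ((k + 2 : ℕ) : ℝ) *
      (((k + 2 : ℕ) : ℝ) * Real.log M + logMoment (k + 2) t)) =
      1 / ((k + 2 : ℕ) : ℝ) * (((k + 2 : ℕ) : ℝ) * Real.log M + lam * logMoment (k + 2) t) := by
    field_simp
    ring
  rw [this]
  gcongr

theorem noise_norm_le_of_le (q : ℕ) (hq : 2 ≤ q) {ε x y : ℝ} (hε0 : 0 ≤ ε) (hε1 : ε ≤ 1 / 2)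
    (hy : 0 ≤ y) (hyx : y ≤ x) :
    ((|(1 - ε) * x + ε * y| ^ q + |ε * x + (1 - ε) * y| ^ q) / 2) ^ ((1 : ℝ) / q) ≤
      ((x + y) / 2) ^ (1 - (1 + 1 / ((q : ℝ) - 1) * Real.logb 2 (ε ^ q + (1 - ε) ^ q))) *
        (((|x| ^ q + |y| ^ q) / 2) ^ ((1 : ℝ) / q)) ^
          (1 + 1 / ((q : ℝ) - 1) * Real.logb 2 (ε ^ q + (1 - ε) ^ q)) := by
  have hx : 0 ≤ x := hy.trans hyx
  have hε : 0 ≤ 1 - ε := by linarith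
  rcases hx.eq_or_lt with rfl | hx0
  · obtain rfl : y = 0 := le_antisymm hyx hy
    have hq0 : q ≠ 0 := by omega
    have : ((1 : ℝ) / q) ≠ 0 := by positivity
    simp only [mul_zero, add_zero, abs_zero, zero_pow hq0, zero_div, Real.zero_rpow this]
    positivity
  have hM : 0 < (x + y) / 2 := by positivity
  have h := noise_norm_le_of_mean q hq hε0 hε1 hM (t := (x - y) / (x + y))
    (div_nonneg (by linarith) (by positivity)) ((div_le_one (by positivity)).2 (by linarith))
  have scale : ∀ c : ℝ, ((x + y) / 2) ^ q * (powSum q (c * ((x - y) / (x + y))) / 2) =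
      (((x + y + c * (x - y)) / 2) ^ q + ((x + y - c * (x - y)) / 2) ^ q) / 2 := by
    intro c
    have hxy : x + y ≠ 0 := by positivity
    rw [powSum, mul_div_assoc', mul_add, ← mul_pow, ← mul_pow]
    congr 3 <;> field_simp
  have h1 := scale 1
  have e1 : (x + y + (1 - 2 * ε) * (x - y)) / 2 = (1 - ε) * x + ε * y := by ring
  have e2 : (x + y - (1 - 2 * ε) * (x - y)) / 2 = ε * x + (1 - ε) * y := by ring
  have e3 : (x + y + (x - y)) / 2 = x := by ring
  have e4 : (x + y - (x - y)) / 2 = y := by ring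
  rw [one_mul, one_mul, e3, e4] at h1
  rw [scale, h1, e1, e2] at h
  rwa [abs_of_nonneg (by positivity : 0 ≤ (1 - ε) * x + ε * y),
    abs_of_nonneg (by positivity : 0 ≤ ε * x + (1 - ε) * y), abs_of_nonneg hx, abs_of_nonneg hy]


/-- **Proposition (one-dimensional inequality, `ℓ_q`).** Let `q ≥ 2` be an integer,
`0 ≤ ε ≤ 1/2`, and `λ = 1 + (1/(q-1))·log₂(ε^q + (1-ε)^q)`. For every nonnegative
function `f` on `{0,1}` (identifying `0 ↔ false`, `1 ↔ true`),
`‖T_ε f‖_q ≤ ‖f‖_1^{1-λ} · ‖f‖_q^{λ}`, where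
`(T_ε f)(0) = (1-ε)f(0) + εf(1)`, `(T_ε f)(1) = εf(0) + (1-ε)f(1)`,
`‖f‖_q = ((|f(0)|^q + |f(1)|^q)/2)^{1/q}` and `‖f‖_1 = (f(0)+f(1))/2`. -/
theorem one_dim_lq_inequality (q : ℕ) (hq : 2 ≤ q)
    (ε : ℝ) (hε0 : 0 ≤ ε) (hε1 : ε ≤ 1 / 2)
    (f : Bool → ℝ) (hf : ∀ b, 0 ≤ f b) :
    ((|(1 - ε) * f false + ε * f true| ^ q + |ε * f false + (1 - ε) * f true| ^ q) / 2) ^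
        ((1 : ℝ) / q) ≤
      ((f false + f true) / 2) ^
          (1 - (1 + 1 / ((q : ℝ) - 1) * Real.logb 2 (ε ^ q + (1 - ε) ^ q))) *
        (((|f false| ^ q + |f true| ^ q) / 2) ^ ((1 : ℝ) / q)) ^
          (1 + 1 / ((q : ℝ) - 1) * Real.logb 2 (ε ^ q + (1 - ε) ^ q)) := by
  rcases le_total (f true) (f false) with h | h
  · exact noise_norm_le_of_le q hq hε0 hε1 (hf true) h
  · have := noise_norm_le_of_le q hq hε0 hε1 (hf false) h
    rwa [add_comm (f true), add_comm (|f true| ^ q), add_comm (_ ^ q) (|_| ^ q),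
      add_comm (ε * f true), add_comm ((1 - ε) * f true)] at this
end

section
/- Let q ≥ 2 be an integer, let 0 ≤ ε ≤ 1/2, and set λ = 1 + (1/(q-1))·log₂(ε^q + (1-ε)^q). If f : {0,1} → ℝ is the characteristic function of the point 0 (i.e. f(0) = 1, f(1) = 0), then equality holds: ‖T_ε f‖_q = ‖f‖_1^{1-λ} · ‖f‖_q^{λ}. -/
/-- **Proposition (tightness for a characteristic function of a point, one dimension).**
Let `q ≥ 2` be an integer, `0 ≤ ε ≤ 1/2`, and
`λ = 1 + (1/(q-1))·log₂(ε^q + (1-ε)^q)`. If `f(0) = 1` and `f(1) = 0`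
(identifying `0 ↔ false`, `1 ↔ true`), then `‖T_ε f‖_q = ‖f‖_1^{1-λ} · ‖f‖_q^{λ}`, where
`(T_ε f)(0) = (1-ε)f(0) + εf(1)`, `(T_ε f)(1) = εf(0) + (1-ε)f(1)`,
`‖f‖_q = ((|f(0)|^q + |f(1)|^q)/2)^{1/q}` and `‖f‖_1 = (f(0)+f(1))/2`. -/
theorem one_dim_lq_equality_char_point (q : ℕ) (hq : 2 ≤ q)
    (ε : ℝ) (hε0 : 0 ≤ ε) (hε1 : ε ≤ 1 / 2)
    (f : Bool → ℝ) (hf0 : f false = 1) (hf1 : f true = 0) :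
    ((|(1 - ε) * f false + ε * f true| ^ q + |ε * f false + (1 - ε) * f true| ^ q) / 2) ^
        ((1 : ℝ) / q) =
      ((f false + f true) / 2) ^
          (1 - (1 + 1 / ((q : ℝ) - 1) * Real.logb 2 (ε ^ q + (1 - ε) ^ q))) *
        (((|f false| ^ q + |f true| ^ q) / 2) ^ ((1 : ℝ) / q)) ^
          (1 + 1 / ((q : ℝ) - 1) * Real.logb 2 (ε ^ q + (1 - ε) ^ q)) := by
  have hq0 : q ≠ 0 := by omega
  have hqR : (2 : ℝ) ≤ q := by exact_mod_cast hq
  have hqR0 : (q : ℝ) ≠ 0 := by linarith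
  have hqR1 : (q : ℝ) - 1 ≠ 0 := by linarith
  have hε' : 0 < 1 - ε := by linarith
  have hS : 0 < ε ^ q + (1 - ε) ^ q := by positivity
  rw [hf0, hf1]
  simp only [mul_one, mul_zero, add_zero, abs_one, abs_zero, one_pow, zero_pow hq0,
    abs_of_nonneg hε0, abs_of_pos hε']
  rw [add_comm ((1 - ε) ^ q)]
  set S := ε ^ q + (1 - ε) ^ q
  set L := Real.logb 2 S with hL
  have hSL : S = 2 ^ L := (Real.rpow_logb two_pos (by norm_num) hS).symm
  have half : (1 / 2 : ℝ) = 2 ^ (-1 : ℝ) := by rw [Real.rpow_neg_one, one_div]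
  rw [div_eq_mul_one_div S, hSL, half, ← Real.rpow_add two_pos]
  simp only [← Real.rpow_mul two_pos.le]
  rw [← Real.rpow_add two_pos]
  congr 1
  field_simp
  ring
end

section
/- Let q ≥ 2 be an integer and define F(y) = ln(((1-y)^q + (1+y)^q)/2) for 0 < y ≤ 1. Then the function G(z) = ln(F(e^z)) is concave on the interval (-∞, 0]. -/
/-- The even part of `(1 + y) ^ k`. -/
noncomputable def evenPart (k : ℕ) (y : ℝ) : ℝ := ((1 - y) ^ k + (1 + y) ^ k) / 2

/-- The odd part of `(1 + y) ^ k`. -/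
noncomputable def oddPart (k : ℕ) (y : ℝ) : ℝ := ((1 + y) ^ k - (1 - y) ^ k) / 2

lemma evenPart_succ (k : ℕ) (y : ℝ) :
    evenPart (k + 1) y = evenPart k y + y * oddPart k y := by
  unfold evenPart oddPart; ring

lemma oddPart_succ (k : ℕ) (y : ℝ) :
    oddPart (k + 1) y = oddPart k y + y * evenPart k y := by
  unfold evenPart oddPart; ring

lemma evenPart_mul_sub_sq_oddPart (n : ℕ) (y : ℝ) :
    evenPart n y * evenPart (n + 2) y - oddPart (n + 1) y ^ 2 = (1 - y ^ 2) ^ n := by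
  have h : (1 - y ^ 2) ^ n = (1 - y) ^ n * (1 + y) ^ n := by rw [← mul_pow]; ring
  rw [h]; unfold evenPart oddPart; ring

lemma hasDerivAt_evenPart (k : ℕ) (y : ℝ) :
    HasDerivAt (evenPart (k + 1)) ((k + 1) * oddPart k y) y := by
  have h := ((((hasDerivAt_id y).const_sub 1).pow (k + 1)).add
    (((hasDerivAt_id y).const_add 1).pow (k + 1))).div_const 2
  refine h.congr_deriv ?_
  simp [oddPart]; ring

lemma hasDerivAt_oddPart (k : ℕ) (y : ℝ) :
    HasDerivAt (oddPart (k + 1)) ((k + 1) * evenPart k y) y := by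
  have h := ((((hasDerivAt_id y).const_add 1).pow (k + 1)).sub
    (((hasDerivAt_id y).const_sub 1).pow (k + 1))).div_const 2
  refine h.congr_deriv ?_
  simp [evenPart]; ring

lemma one_le_evenPart_and_oddPart_nonneg (k : ℕ) {y : ℝ} (hy : 0 ≤ y) :
    1 ≤ evenPart k y ∧ 0 ≤ oddPart k y := by
  induction k with
  | zero => simp [evenPart, oddPart]
  | succ k ih =>
    rw [evenPart_succ, oddPart_succ]
    have h1 := mul_nonneg hy ih.2
    have h2 := mul_nonneg hy (zero_le_one.trans ih.1)
    constructor <;> linarith [ih.1, ih.2]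

lemma evenPart_pos (k : ℕ) {y : ℝ} (hy : 0 ≤ y) : 0 < evenPart k y :=
  zero_lt_one.trans_le (one_le_evenPart_and_oddPart_nonneg k hy).1

lemma oddPart_succ_pos (k : ℕ) {y : ℝ} (hy : 0 < y) : 0 < oddPart (k + 1) y := by
  rw [oddPart_succ]
  have := mul_pos hy (evenPart_pos k hy.le)
  linarith [(one_le_evenPart_and_oddPart_nonneg k hy.le).2]

lemma one_lt_evenPart (k : ℕ) {y : ℝ} (hy : 0 < y) : 1 < evenPart (k + 2) y := by
  rw [evenPart_succ]
  have := mul_pos hy (oddPart_succ_pos k hy)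
  linarith [(one_le_evenPart_and_oddPart_nonneg (k + 1) hy.le).1]

lemma oddPart_le_evenPart (k : ℕ) {y : ℝ} (hy : y ≤ 1) : oddPart k y ≤ evenPart k y := by
  have := pow_nonneg (sub_nonneg.2 hy) k
  unfold oddPart evenPart; linarith

lemma evenPart_le_and_oddPart_le (k : ℕ) {x y : ℝ} (hx : 0 ≤ x) (hxy : x ≤ y) :
    evenPart k x ≤ evenPart k y ∧ oddPart k x ≤ oddPart k y := by
  induction k with
  | zero => simp [evenPart, oddPart]
  | succ k ih =>
    simp only [evenPart_succ, oddPart_succ]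
    have h := one_le_evenPart_and_oddPart_nonneg k hx
    have h1 := mul_le_mul hxy ih.1 (zero_le_one.trans h.1) (hx.trans hxy)
    have h2 := mul_le_mul hxy ih.2 h.2 (hx.trans hxy)
    constructor <;> linarith [ih.1, ih.2]

lemma mul_oddPart_le (k : ℕ) {x y : ℝ} (hx : 0 ≤ x) (hxy : x ≤ y) :
    y * oddPart k x ≤ x * oddPart k y := by
  induction k with
  | zero => simp [oddPart]
  | succ k ih =>
    simp only [oddPart_succ]
    have := mul_le_mul_of_nonneg_left (evenPart_le_and_oddPart_le k hx hxy).1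
      (mul_nonneg hx (hx.trans hxy))
    linarith

lemma oddPart_mul_evenPart_le (k : ℕ) {x y : ℝ} (hx : 0 ≤ x) (hxy : x ≤ y) (hy : y ≤ 1) :
    oddPart k x * evenPart k y ≤ oddPart k y * evenPart k x := by
  induction k with
  | zero => simp [oddPart]
  | succ k ih =>
    simp only [oddPart_succ, evenPart_succ]
    have h1 : x * y ≤ 1 := mul_le_one₀ (hxy.trans hy) (hx.trans hxy) hy
    have h2 : oddPart k x * oddPart k y ≤ evenPart k x * evenPart k y :=
      mul_le_mul (oddPart_le_evenPart k (hxy.trans hy)) (oddPart_le_evenPart k hy)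
        (one_le_evenPart_and_oddPart_nonneg k (hx.trans hxy)).2 (evenPart_pos k hx).le
    have h3 := mul_nonneg (sub_nonneg.2 ih) (sub_nonneg.2 h1)
    have h4 := mul_nonneg (sub_nonneg.2 hxy) (sub_nonneg.2 h2)
    linarith

/-- The quotient `(y F'(y))' / F'(y)` for `F = log (evenPart (n + 2))`. -/
noncomputable def derivRatio (n : ℕ) (y : ℝ) : ℝ :=
  evenPart (n + 1) y / evenPart (n + 2) y +
    (n + 1) * (y / oddPart (n + 1) y * (1 - y ^ 2) ^ n / evenPart (n + 2) y)

lemma derivRatio_le (n : ℕ) {x y : ℝ} (hx : 0 < x) (hxy : x ≤ y) (hy : y ≤ 1) :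
    derivRatio n y ≤ derivRatio n x := by
  have hy0 := hx.trans_le hxy
  have hsx := oddPart_succ_pos n hx
  have hsy := oddPart_succ_pos n hy0
  have hcx := evenPart_pos (n + 1) hx.le
  have hcy := evenPart_pos (n + 1) hy0.le
  have hex := evenPart_pos (n + 2) hx.le
  have hey := evenPart_pos (n + 2) hy0.le
  have hmono := (evenPart_le_and_oddPart_le (n + 2) hx.le hxy).1
  have hsq : 0 ≤ 1 - y ^ 2 := by nlinarith
  have hsq' : 1 - y ^ 2 ≤ 1 - x ^ 2 := by nlinarith
  have hquot : y / oddPart (n + 1) y ≤ x / oddPart (n + 1) x := by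
    rw [div_le_div_iff₀ hsy hsx]
    exact mul_oddPart_le (n + 1) hx.le hxy
  unfold derivRatio
  gcongr ?_ + (n + 1) * (?_ * ?_ / ?_)
  · rw [div_le_div_iff₀ hey hex, evenPart_succ (n + 1), evenPart_succ (n + 1)]
    have := mul_le_mul hxy (oddPart_mul_evenPart_le (n + 1) hx.le hxy hy)
      (mul_pos hsx hcy).le hy0.le
    linarith
  · have := pow_nonneg (hsq.trans hsq') n
    positivity
  · exact pow_le_pow_left₀ hsq hsq' n

/-- The derivative of `log (evenPart (n + 2))`. -/
noncomputable def logDerivEven (n : ℕ) (y : ℝ) : ℝ :=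
  (n + 2) * oddPart (n + 1) y / evenPart (n + 2) y

lemma hasDerivAt_log_evenPart (n : ℕ) {y : ℝ} (hy : 0 ≤ y) :
    HasDerivAt (fun y => Real.log (evenPart (n + 2) y)) (logDerivEven n y) y := by
  refine ((hasDerivAt_evenPart (n + 1) y).log (evenPart_pos (n + 2) hy).ne').congr_deriv ?_
  unfold logDerivEven; push_cast; ring

lemma hasDerivAt_mul_logDerivEven (n : ℕ) {y : ℝ} (hy : 0 < y) :
    HasDerivAt (fun y => y * logDerivEven n y) (derivRatio n y * logDerivEven n y) y := by
  have hs := (oddPart_succ_pos n hy).ne'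
  have hc := (evenPart_pos (n + 2) hy.le).ne'
  refine ((hasDerivAt_id y).mul (((hasDerivAt_oddPart n y).const_mul ((n : ℝ) + 2)).div
    (hasDerivAt_evenPart (n + 1) y) hc)).congr_deriv ?_
  have h1 := evenPart_mul_sub_sq_oddPart n y
  have h2 := evenPart_succ (n + 1) y
  unfold derivRatio logDerivEven
  rw [← h1, show evenPart (n + 1) y = evenPart (n + 2) y - y * oddPart (n + 1) y by
    rw [h2]; ring]
  simp only [id, Pi.div_apply]
  field_simp
  push_cast
  ring

lemma continuousOn_mul_logDerivEven (n : ℕ) :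
    ContinuousOn (fun y => y * logDerivEven n y) (Set.Ici 0) := by
  intro y hy
  have hc := (evenPart_pos (n + 2) hy).ne'
  exact (continuousAt_id.mul ((((hasDerivAt_oddPart n y).continuousAt).const_mul
    ((n : ℝ) + 2)).div (hasDerivAt_evenPart (n + 1) y).continuousAt hc)).continuousWithinAt

lemma derivRatio_mul_log_le (n : ℕ) {y : ℝ} (hy : 0 < y) (hy1 : y ≤ 1) :
    derivRatio n y * Real.log (evenPart (n + 2) y) ≤ y * logDerivEven n y := by
  have hmono : MonotoneOn (fun u => u * logDerivEven n u -
      derivRatio n y * Real.log (evenPart (n + 2) u)) (Set.Icc 0 y) := by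
    refine monotoneOn_of_hasDerivWithinAt_nonneg (convex_Icc 0 y)
      (f' := fun u => derivRatio n u * logDerivEven n u - derivRatio n y * logDerivEven n u)
      ?_ ?_ ?_
    · refine ((continuousOn_mul_logDerivEven n).mono Set.Icc_subset_Ici_self).sub
        (ContinuousOn.const_mul ?_ _)
      exact fun u hu => (hasDerivAt_log_evenPart n hu.1).continuousAt.continuousWithinAt
    · intro u hu
      rw [interior_Icc] at hu
      exact ((hasDerivAt_mul_logDerivEven n hu.1).sub
        ((hasDerivAt_log_evenPart n hu.1.le).const_mul _)).hasDerivWithinAt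
    · intro u hu
      rw [interior_Icc] at hu
      have hpos : 0 ≤ logDerivEven n u := by
        have := oddPart_succ_pos n hu.1
        have := evenPart_pos (n + 2) hu.1.le
        unfold logDerivEven
        positivity
      rw [← sub_mul]
      exact mul_nonneg (sub_nonneg.2 (derivRatio_le n hu.1 hu.2.le hy1)) hpos
  have h := hmono (Set.left_mem_Icc.2 hy.le) (Set.right_mem_Icc.2 hy.le) hy.le
  have h0 : evenPart (n + 2) 0 = 1 := by simp [evenPart]
  simp only [h0, Real.log_one, zero_mul, mul_zero, sub_zero] at h
  linarith

lemma antitoneOn_elasticity_log_evenPart (n : ℕ) :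
    AntitoneOn (fun y => y * logDerivEven n y / Real.log (evenPart (n + 2) y))
      (Set.Ioo 0 1) := by
  have hder : ∀ y ∈ Set.Ioo (0 : ℝ) 1, HasDerivAt
      (fun y => y * logDerivEven n y / Real.log (evenPart (n + 2) y))
      ((derivRatio n y * logDerivEven n y * Real.log (evenPart (n + 2) y) -
        y * logDerivEven n y * logDerivEven n y) / Real.log (evenPart (n + 2) y) ^ 2) y :=
    fun y hy => (hasDerivAt_mul_logDerivEven n hy.1).div (hasDerivAt_log_evenPart n hy.1.le)
      (Real.log_pos (one_lt_evenPart n hy.1)).ne'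
  refine antitoneOn_of_hasDerivWithinAt_nonpos (convex_Ioo 0 1)
    (fun y hy => (hder y hy).continuousAt.continuousWithinAt)
    (fun y hy => (hder y (interior_subset hy)).hasDerivWithinAt) fun y hy => ?_
  replace hy := interior_subset hy
  have hpos : 0 ≤ logDerivEven n y := by
    have := oddPart_succ_pos n hy.1
    have := evenPart_pos (n + 2) hy.1.le
    unfold logDerivEven
    positivity
  refine div_nonpos_of_nonpos_of_nonneg ?_ (sq_nonneg _)
  have := mul_le_mul_of_nonneg_right (derivRatio_mul_log_le n hy.1 hy.2.le) hpos
  linarith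

/-- **Lemma (concavity of `G`).** Let `q ≥ 2` be an integer and
`F(y) = ln(((1-y)^q + (1+y)^q)/2)` for `0 < y ≤ 1`. Then `G(z) = ln(F(e^z))` is concave
on `(-∞, 0]`. -/
theorem concave_log_F_exp (q : ℕ) (hq : 2 ≤ q) :
    ConcaveOn ℝ (Set.Iic (0 : ℝ))
      (fun z : ℝ =>
        Real.log (Real.log (((1 - Real.exp z) ^ q + (1 + Real.exp z) ^ q) / 2))) := by
  obtain ⟨n, rfl⟩ := Nat.exists_eq_add_of_le' hq
  change ConcaveOn ℝ (Set.Iic (0 : ℝ))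
    (fun z : ℝ => Real.log (Real.log (evenPart (n + 2) (Real.exp z))))
  have hder : ∀ z : ℝ, HasDerivAt
      (fun z : ℝ => Real.log (Real.log (evenPart (n + 2) (Real.exp z))))
      (Real.exp z * logDerivEven n (Real.exp z) /
        Real.log (evenPart (n + 2) (Real.exp z))) z := by
    intro z
    have hz := Real.exp_pos z
    refine (((hasDerivAt_log_evenPart n hz.le).comp z (Real.hasDerivAt_exp z)).log
      (Real.log_pos (one_lt_evenPart n hz)).ne').congr_deriv ?_
    simp only [Function.comp_apply, mul_comm]
  refine AntitoneOn.concaveOn_of_deriv (convex_Iic 0)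
    (fun z _ => (hder z).continuousAt.continuousWithinAt)
    (fun z _ => (hder z).differentiableAt.differentiableWithinAt) ?_
  rw [interior_Iic]
  intro a ha b hb hab
  rw [(hder a).deriv, (hder b).deriv]
  exact antitoneOn_elasticity_log_evenPart n ⟨Real.exp_pos a, Real.exp_lt_one_iff.2 ha⟩
    ⟨Real.exp_pos b, Real.exp_lt_one_iff.2 hb⟩ (Real.exp_le_exp.2 hab)
end

section
/- Let q ≥ 2 be an integer and define F(y) = ln(((1-y)^q + (1+y)^q)/2). Then for all 0 ≤ ε ≤ 1/2 and all 0 < x ≤ 1, F((1-2ε)·x) · F(1) ≤ F(1-2ε) · F(x). (Equivalently, since F(x) > 0 for 0 < x ≤ 1: F((1-2ε)x)/F(x) ≤ F(1-2ε)/F(1).) -/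
/-- For `j ≤ k`, the ratio `cosh (k t) / cosh (j t)` is increasing in `t ≥ 0`. -/
theorem cosh_mul_cosh_le_cosh_mul_cosh {j k a b : ℝ} (hj : 0 ≤ j) (hjk : j ≤ k) (ha : 0 ≤ a)
    (hab : a ≤ b) :
    Real.cosh (k * a) * Real.cosh (j * b) ≤ Real.cosh (k * b) * Real.cosh (j * a) := by
  have h1 : Real.cosh (k * a + j * b) ≤ Real.cosh (k * b + j * a) := by
    have hk := hj.trans hjk
    have hb := ha.trans hab
    rw [Real.cosh_le_cosh, abs_of_nonneg (by positivity), abs_of_nonneg (by positivity)]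
    nlinarith [mul_nonneg (sub_nonneg.2 hjk) (sub_nonneg.2 hab)]
  have h2 : Real.cosh (k * a - j * b) ≤ Real.cosh (k * b - j * a) := by
    rw [Real.cosh_le_cosh, ← sq_le_sq]
    have h3 : 0 ≤ (k ^ 2 - j ^ 2) * (b ^ 2 - a ^ 2) :=
      mul_nonneg (by nlinarith) (by nlinarith)
    nlinarith
  rw [Real.cosh_add, Real.cosh_add] at h1
  rw [Real.cosh_sub, Real.cosh_sub] at h2
  linarith

/-- The sum `∑ cosh (k t)` over `1 ≤ k ≤ n`. -/
noncomputable def coshSum (n : ℕ) (t : ℝ) : ℝ :=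
  ∑ k ∈ Finset.Icc 1 n, Real.cosh (k * t)

theorem coshSum_pos {n : ℕ} (hn : 1 ≤ n) (t : ℝ) : 0 < coshSum n t :=
  Finset.sum_pos (fun _ _ => Real.cosh_pos _) ⟨1, by simp [hn]⟩

/-- The ratio `(cosh (n t) - n cosh t - (n + 1)) / ∑ cosh (k t)` is increasing in `t ≥ 0`. -/
theorem cosh_ratio_mono {n : ℕ} (hn : 1 ≤ n) {a b : ℝ} (ha : 0 ≤ a) (hab : a ≤ b) :
    (Real.cosh (n * a) - n * Real.cosh a - (n + 1)) / coshSum n a ≤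
      (Real.cosh (n * b) - n * Real.cosh b - (n + 1)) / coshSum n b := by
  rw [div_le_div_iff₀ (coshSum_pos hn a) (coshSum_pos hn b)]
  have h1 : Real.cosh (n * a) * coshSum n b ≤ Real.cosh (n * b) * coshSum n a := by
    unfold coshSum
    rw [Finset.mul_sum, Finset.mul_sum]
    refine Finset.sum_le_sum fun k hk => ?_
    rw [Finset.mem_Icc] at hk
    exact cosh_mul_cosh_le_cosh_mul_cosh (by positivity) (by exact_mod_cast hk.2) ha hab
  have h2 : Real.cosh b * coshSum n a ≤ Real.cosh a * coshSum n b := by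
    unfold coshSum
    rw [Finset.mul_sum, Finset.mul_sum]
    refine Finset.sum_le_sum fun k hk => ?_
    rw [Finset.mem_Icc] at hk
    have := cosh_mul_cosh_le_cosh_mul_cosh (j := 1) (k := k) zero_le_one
      (by exact_mod_cast hk.1) ha hab
    rw [one_mul, one_mul] at this
    linarith
  have h3 : coshSum n a ≤ coshSum n b := by
    refine Finset.sum_le_sum fun k _ => ?_
    rw [Real.cosh_le_cosh, abs_of_nonneg (by positivity),
      abs_of_nonneg (by have := ha.trans hab; positivity)]
    gcongr
  have hn0 : (0 : ℝ) ≤ n := by positivity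
  nlinarith [mul_le_mul_of_nonneg_left h2 hn0, mul_le_mul_of_nonneg_left h3 hn0]

theorem two_mul_pow_mul_cosh_log_div {p m : ℝ} (hp : 0 < p) (hm : 0 < m) (k : ℕ) :
    2 * (p * m) ^ k * Real.cosh (k * Real.log (p / m)) = p ^ (2 * k) + m ^ (2 * k) := by
  rw [← Real.log_pow, Real.cosh_log (by positivity), div_pow, mul_pow]
  field_simp
  ring

theorem sub_mul_coshSum_log_div {p m : ℝ} (hp : 0 < p) (hm : 0 < m) (n : ℕ) :
    (p - m) * (2 * (p * m) ^ n * coshSum n (Real.log (p / m))) =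
      (p ^ n - m ^ n) * (p ^ (n + 1) + m ^ (n + 1)) := by
  induction n with
  | zero => simp [coshSum]
  | succ n ih =>
    have h := two_mul_pow_mul_cosh_log_div hp hm (n + 1)
    have hs : coshSum (n + 1) (Real.log (p / m)) =
        coshSum n (Real.log (p / m)) + Real.cosh ((n + 1 : ℕ) * Real.log (p / m)) := by
      unfold coshSum
      rw [Finset.sum_Icc_succ_top (by omega)]
    rw [hs]
    linear_combination (p * m) * ih + (p - m) * h

/-- The logarithmic derivative of `((1 + y)^n - (1 - y)^n) / ((1 + y)^(n+1) + (1 - y)^(n+1))`,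
in hyperbolic form. -/
theorem hasDerivAt_log_ratio {n : ℕ} (hn : 1 ≤ n) {y : ℝ} (hy0 : 0 < y) (hy1 : y < 1) :
    HasDerivAt (fun y : ℝ => Real.log ((1 + y) ^ n - (1 - y) ^ n) -
        Real.log ((1 + y) ^ (n + 1) + (1 - y) ^ (n + 1)))
      (-(1 / 2) * ((Real.cosh (n * Real.log ((1 + y) / (1 - y))) -
        n * Real.cosh (Real.log ((1 + y) / (1 - y))) - (n + 1)) /
          coshSum n (Real.log ((1 + y) / (1 - y)))) / y) y := by
  have hp : 0 < 1 + y := by linarith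
  have hm : 0 < 1 - y := by linarith
  have hM : 0 < (1 + y) ^ n - (1 - y) ^ n :=
    sub_pos.2 (pow_lt_pow_left₀ (by linarith) hm.le (by omega))
  have hD : 0 < (1 + y) ^ (n + 1) + (1 - y) ^ (n + 1) := by positivity
  have dp : HasDerivAt (fun y : ℝ => 1 + y) 1 y := (hasDerivAt_id y).const_add 1
  have dm : HasDerivAt (fun y : ℝ => 1 - y) (-1) y := (hasDerivAt_id y).const_sub 1
  have d := (((dp.pow n).sub (dm.pow n)).log hM.ne').sub
    (((dp.pow (n + 1)).add (dm.pow (n + 1))).log hD.ne')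
  refine d.congr_deriv ?_
  simp only [Pi.add_apply, Pi.sub_apply, Pi.pow_apply]
  have hS := coshSum_pos hn (Real.log ((1 + y) / (1 - y)))
  have h1 := sub_mul_coshSum_log_div hp hm n
  have h2 := two_mul_pow_mul_cosh_log_div hp hm n
  have h3 := two_mul_pow_mul_cosh_log_div hp hm 1
  rw [Nat.cast_one, one_mul] at h3
  obtain ⟨l, rfl⟩ : ∃ l, n = l + 1 := ⟨n - 1, by omega⟩
  generalize coshSum (l + 1) (Real.log ((1 + y) / (1 - y))) = S at *
  generalize Real.cosh (((l + 1 : ℕ) : ℝ) * Real.log ((1 + y) / (1 - y))) = C at *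
  generalize Real.cosh (Real.log ((1 + y) / (1 - y))) = c at *
  have hQ : ((1 + y) * (1 - y)) ^ (l + 1) ≠ 0 := by positivity
  rw [div_sub_div _ _ hM.ne' hD.ne', ← h1]
  have h4 : ((l + 1 : ℕ) * (1 + y) ^ (l + 1 - 1) * 1 - (l + 1 : ℕ) * (1 - y) ^ (l + 1 - 1) * (-1))
      * ((1 + y) ^ (l + 1 + 1) + (1 - y) ^ (l + 1 + 1)) -
      ((1 + y) ^ (l + 1) - (1 - y) ^ (l + 1)) *
      ((l + 1 + 1 : ℕ) * (1 + y) ^ (l + 1 + 1 - 1) * 1 +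
        (l + 1 + 1 : ℕ) * (1 - y) ^ (l + 1 + 1 - 1) * (-1)) =
      -(2 * ((1 + y) * (1 - y)) ^ (l + 1) * (C - (l + 1 : ℕ) * c - ((l + 1 : ℕ) + 1))) := by
    simp only [Nat.add_sub_cancel]
    push_cast
    generalize hpe : 1 + y = p at *
    generalize hme : 1 - y = m at *
    linear_combination h2 - (l + 1) * (p * m) ^ l * h3
  rw [h4, show 1 + y - (1 - y) = 2 * y by ring]
  field_simp

/-- If `f = ((1 + y)^n - (1 - y)^n) / ((1 + y)^(n+1) + (1 - y)^(n+1))` then `f (c y) / f y` is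
increasing in `y`. -/
theorem ratio_mul_ratio_le {n : ℕ} (hn : 1 ≤ n) {f : ℝ → ℝ}
    (hf : ∀ y, f y = ((1 + y) ^ n - (1 - y) ^ n) / ((1 + y) ^ (n + 1) + (1 - y) ^ (n + 1)))
    (hpos : ∀ y, 0 < y → y < 1 → 0 < f y) {c a b : ℝ}
    (hc0 : 0 < c) (hc1 : c ≤ 1) (ha : 0 < a) (hab : a ≤ b) (hb : b < 1) :
    f (c * a) * f b ≤ f (c * b) * f a := by
  set V : ℝ → ℝ := fun t => (Real.cosh (n * t) - n * Real.cosh t - (n + 1)) / coshSum n t with hV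
  have hderiv : ∀ y, 0 < y → y < 1 → HasDerivAt (fun y => Real.log (f y))
      (-(1 / 2) * V (Real.log ((1 + y) / (1 - y))) / y) y := by
    intro y hy0 hy1
    refine (hasDerivAt_log_ratio hn hy0 hy1).congr_of_eventuallyEq ?_
    filter_upwards [Ioo_mem_nhds hy0 hy1] with z hz
    have hm : 0 < 1 - z := by linarith [hz.2]
    have hp : 0 < 1 + z := by linarith [hz.1]
    have hM : 0 < (1 + z) ^ n - (1 - z) ^ n :=
      sub_pos.2 (pow_lt_pow_left₀ (by linarith [hz.1]) hm.le (by omega))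
    rw [hf, Real.log_div hM.ne' (by positivity)]
  have hcy : ∀ y, 0 < y → y < 1 → 0 < c * y ∧ c * y ≤ y ∧ c * y < 1 := fun y h0 h1 =>
    ⟨by positivity, by nlinarith, by nlinarith⟩
  have hd : ∀ y ∈ Set.Ioo (0 : ℝ) 1, HasDerivAt (fun y => Real.log (f (c * y)) - Real.log (f y))
      (-(1 / 2) * V (Real.log ((1 + c * y) / (1 - c * y))) / (c * y) * c -
        -(1 / 2) * V (Real.log ((1 + y) / (1 - y))) / y) y := by
    intro y hy
    obtain ⟨h0, -, h1⟩ := hcy y hy.1 hy.2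
    have hlin : HasDerivAt (fun y : ℝ => c * y) c y := by
      simpa using (hasDerivAt_id y).const_mul c
    exact ((hderiv (c * y) h0 h1).comp y hlin).sub (hderiv y hy.1 hy.2)
  have hmono : MonotoneOn (fun y => Real.log (f (c * y)) - Real.log (f y)) (Set.Ioo 0 1) := by
    refine monotoneOn_of_deriv_nonneg (convex_Ioo 0 1)
      (fun y hy => (hd y hy).continuousAt.continuousWithinAt)
      (fun y hy => (hd y (interior_subset hy)).differentiableAt.differentiableWithinAt) ?_
    intro y hy
    have hy := interior_subset hy
    obtain ⟨h0, hle, h1⟩ := hcy y hy.1 hy.2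
    have hy0 := hy.1
    have hy1 : 0 < 1 - y := by linarith [hy.2]
    have hcy1 : 0 < 1 - c * y := by linarith
    have hVle : V (Real.log ((1 + c * y) / (1 - c * y))) ≤ V (Real.log ((1 + y) / (1 - y))) := by
      refine cosh_ratio_mono hn (Real.log_nonneg ?_) (Real.log_le_log (by positivity) ?_)
      · rw [one_le_div hcy1]
        linarith
      · gcongr
    rw [(hd y hy).deriv]
    have heq : -(1 / 2) * V (Real.log ((1 + c * y) / (1 - c * y))) / (c * y) * c -
        -(1 / 2) * V (Real.log ((1 + y) / (1 - y))) / y =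
        (1 / 2) * (V (Real.log ((1 + y) / (1 - y))) -
          V (Real.log ((1 + c * y) / (1 - c * y)))) / y := by
      field_simp
      ring
    rw [heq]
    have := sub_nonneg.2 hVle
    positivity
  have hb0 := ha.trans_le hab
  have ha1 := hab.trans_lt hb
  have h := hmono ⟨ha, ha1⟩ ⟨hb0, hb⟩ hab
  have fa := hpos a ha ha1
  have fb := hpos b hb0 hb
  have fca := hpos _ (hcy a ha ha1).1 (hcy a ha ha1).2.2
  have fcb := hpos _ (hcy b hb0 hb).1 (hcy b hb0 hb).2.2
  rw [← Real.log_le_log_iff (by positivity) (by positivity), Real.log_mul fca.ne' fb.ne',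
    Real.log_mul fcb.ne' fa.ne']
  simp only at h
  linarith

/-- A monotone form of l'Hôpital's rule: if `A' / B'` is increasing on `(0, 1)` and `A`, `B`
vanish at `0`, then `A x / B x ≤ A 1 / B 1`. -/
theorem mul_le_mul_of_deriv_ratio_mono {A B A' B' : ℝ → ℝ}
    (hAc : ContinuousOn A (Set.Icc 0 1)) (hBc : ContinuousOn B (Set.Icc 0 1))
    (hA : ∀ y ∈ Set.Ioo (0 : ℝ) 1, HasDerivAt A (A' y) y)
    (hB : ∀ y ∈ Set.Ioo (0 : ℝ) 1, HasDerivAt B (B' y) y)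
    (hB' : ∀ y ∈ Set.Ioo (0 : ℝ) 1, 0 < B' y) (hA0 : A 0 = 0) (hB0 : B 0 = 0)
    (hratio : ∀ a ∈ Set.Ioo (0 : ℝ) 1, ∀ b ∈ Set.Ioo (0 : ℝ) 1, a ≤ b →
      A' a * B' b ≤ A' b * B' a) {x : ℝ} (hx0 : 0 < x) (hx1 : x < 1) :
    A x * B 1 ≤ A 1 * B x := by
  have hmono : StrictMonoOn B (Set.Icc 0 1) := by
    refine strictMonoOn_of_deriv_pos (convex_Icc 0 1) hBc fun y hy => ?_
    rw [interior_Icc] at hy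
    rw [(hB y hy).deriv]
    exact hB' y hy
  have hBx : 0 < B x := by
    rw [← hB0]
    exact hmono ⟨le_rfl, zero_le_one⟩ ⟨hx0.le, hx1.le⟩ hx0
  have hB1 : B x < B 1 := hmono ⟨hx0.le, hx1.le⟩ ⟨zero_le_one, le_rfl⟩ hx1
  obtain ⟨a, ha, hae⟩ := exists_ratio_hasDerivAt_eq_ratio_slope A A' hx0
    (hAc.mono (Set.Icc_subset_Icc_right hx1.le)) (fun y hy => hA y ⟨hy.1, hy.2.trans hx1⟩) B B'
    (hBc.mono (Set.Icc_subset_Icc_right hx1.le)) (fun y hy => hB y ⟨hy.1, hy.2.trans hx1⟩)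
  obtain ⟨b, hb, hbe⟩ := exists_ratio_hasDerivAt_eq_ratio_slope A A' hx1
    (hAc.mono (Set.Icc_subset_Icc_left hx0.le)) (fun y hy => hA y ⟨hx0.trans hy.1, hy.2⟩) B B'
    (hBc.mono (Set.Icc_subset_Icc_left hx0.le)) (fun y hy => hB y ⟨hx0.trans hy.1, hy.2⟩)
  have ha' : a ∈ Set.Ioo (0 : ℝ) 1 := ⟨ha.1, ha.2.trans hx1⟩
  have hb' : b ∈ Set.Ioo (0 : ℝ) 1 := ⟨hx0.trans hb.1, hb.2⟩
  have hr := hratio a ha' b hb' (ha.2.trans hb.1).le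
  have pa := hB' a ha'
  have pb := hB' b hb'
  rw [hA0, hB0, sub_zero, sub_zero] at hae
  have key : (A 1 * B x - A x * B 1) * (B' a * B' b) =
      B x * (B 1 - B x) * (A' b * B' a - A' a * B' b) := by
    linear_combination (-(B x * B' a)) * hbe + (B 1 - B x) * B' b * hae
  have h0 : 0 ≤ (A 1 * B x - A x * B 1) * (B' a * B' b) := by
    rw [key]
    exact mul_nonneg (mul_nonneg hBx.le (sub_nonneg.2 hB1.le)) (sub_nonneg.2 hr)
  exact sub_nonneg.1 (nonneg_of_mul_nonneg_left h0 (mul_pos pa pb))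

/-- **Lemma (the key ratio inequality).** Let `q ≥ 2` be an integer and
`F(y) = ln(((1-y)^q + (1+y)^q)/2)`. Then for all `0 ≤ ε ≤ 1/2` and `0 < x ≤ 1`,
`F((1-2ε)·x) · F(1) ≤ F(1-2ε) · F(x)`. -/
theorem F_ratio_inequality (q : ℕ) (hq : 2 ≤ q)
    (F : ℝ → ℝ) (hF : ∀ y, F y = Real.log (((1 - y) ^ q + (1 + y) ^ q) / 2))
    (ε x : ℝ) (hε0 : 0 ≤ ε) (hε1 : ε ≤ 1 / 2) (hx0 : 0 < x) (hx1 : x ≤ 1) :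
    F ((1 - 2 * ε) * x) * F 1 ≤ F (1 - 2 * ε) * F x := by
  obtain ⟨c, hc⟩ : ∃ c, c = 1 - 2 * ε := ⟨_, rfl⟩
  rw [← hc]
  have hc1 : c ≤ 1 := by linarith
  have hF0 : F 0 = 0 := by
    rw [hF]
    norm_num
  rcases (show 0 ≤ c by linarith).eq_or_lt with h | hc0
  · simp [← h, hF0]
  rcases hx1.eq_or_lt with rfl | hx1
  · rw [mul_one]
  obtain ⟨n, rfl⟩ : ∃ n, q = n + 1 := ⟨q - 1, by omega⟩
  have hn : 1 ≤ n := by omega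
  obtain ⟨f, hf⟩ : ∃ f : ℝ → ℝ, ∀ y, f y =
      ((1 + y) ^ n - (1 - y) ^ n) / ((1 + y) ^ (n + 1) + (1 - y) ^ (n + 1)) :=
    ⟨_, fun _ => rfl⟩
  have hpos : ∀ y, 0 < y → y < 1 → 0 < f y := by
    intro y h0 h1
    have hm : 0 < 1 - y := by linarith
    rw [hf]
    exact div_pos (sub_pos.2 (pow_lt_pow_left₀ (by linarith) hm.le (by omega))) (by positivity)
  have hd : ∀ y, 0 ≤ y → y ≤ 1 → HasDerivAt F ((n + 1) * f y) y := by
    intro y h0 h1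
    have hm : 0 ≤ 1 - y := by linarith
    have hD : 0 < (1 - y) ^ (n + 1) + (1 + y) ^ (n + 1) := by positivity
    have dp : HasDerivAt (fun y : ℝ => 1 + y) 1 y := (hasDerivAt_id y).const_add 1
    have dm : HasDerivAt (fun y : ℝ => 1 - y) (-1) y := (hasDerivAt_id y).const_sub 1
    have d := (((dm.pow (n + 1)).add (dp.pow (n + 1))).div_const 2).log (by
      simp only [Pi.add_apply, Pi.pow_apply]
      positivity)
    rw [funext hF]
    refine d.congr_deriv ?_
    rw [hf, add_comm ((1 + y) ^ (n + 1))]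
    simp only [Pi.add_apply, Pi.pow_apply, Nat.add_sub_cancel]
    push_cast
    field_simp
    ring
  have hcy : ∀ y, 0 ≤ y → y ≤ 1 → 0 ≤ c * y ∧ c * y ≤ 1 := fun y h0 h1 =>
    ⟨by positivity, by nlinarith⟩
  have hdc : ∀ y, 0 ≤ y → y ≤ 1 →
      HasDerivAt (fun y => F (c * y)) ((n + 1) * f (c * y) * c) y := by
    intro y h0 h1
    have hlin : HasDerivAt (fun y : ℝ => c * y) c y := by
      simpa using (hasDerivAt_id y).const_mul c
    exact (hd (c * y) (hcy y h0 h1).1 (hcy y h0 h1).2).comp y hlin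
  have := mul_le_mul_of_deriv_ratio_mono (A := fun y => F (c * y)) (B := F)
    (fun y hy => (hdc y hy.1 hy.2).continuousAt.continuousWithinAt)
    (fun y hy => (hd y hy.1 hy.2).continuousAt.continuousWithinAt)
    (fun y hy => hdc y hy.1.le hy.2.le) (fun y hy => hd y hy.1.le hy.2.le)
    (fun y hy => mul_pos (by positivity) (hpos y hy.1 hy.2)) (by simp [hF0]) hF0
    (fun a ha b hb hab => by
      have h := ratio_mul_ratio_le hn hf hpos hc0 hc1 ha.1 hab hb.2
      have hk : (0 : ℝ) ≤ (n + 1) ^ 2 * c := by positivity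
      nlinarith [mul_le_mul_of_nonneg_left h hk]) hx0 hx1
  simpa using this
end
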